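/- arXiv:1511.07310 — 5 statements merged into one kernel-verified Lean document; each statement's English description precedes it below -/
import Mathlib

section
/- Let G be a finite simple graph whose cycles are pairwise vertex-disjoint, and let n be the number of cycles of G. Then the arithmetical rank of the edge ideal I(G) satisfies ara I(G) ≤ bight I(G) + n, where bight I(G) is the big height of I(G). -/
open SimpleGraph

variable {V : Type}

/-- `C` is a vertex cover of `G`: every edge of `G` has an endpoint in `C`. -/
def IsVC (G : SimpleGraph V) (C : Set V) : Prop :=
  ∀ ⦃u v : V⦄, G.Adj u v → u ∈ C ∨ v ∈ C

/-- `C` is a minimal vertex cover of `G`. -/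
def IsMinVC (G : SimpleGraph V) (C : Set V) : Prop :=
  IsVC G C ∧ ∀ D : Set V, D ⊂ C → ¬ IsVC G D

/-- `C` is a maximum minimal vertex cover of `G`: a minimal vertex cover of
maximal cardinality among minimal vertex covers. -/
def IsMaxMinVC (G : SimpleGraph V) (C : Set V) : Prop :=
  IsMinVC G C ∧ ∀ D : Set V, IsMinVC G D → D.ncard ≤ C.ncard

/-- The big height of the edge ideal of `G`: the maximum cardinality of a
minimal vertex cover of `G`. -/
noncomputable def bight (G : SimpleGraph V) : ℕ :=
  sSup {n : ℕ | ∃ C : Set V, IsMinVC G C ∧ C.ncard = n}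

/-- The edge ideal of `G` in the polynomial ring `k[x_v : v ∈ V]`. -/
noncomputable def edgeIdeal (k : Type) [Field k] (G : SimpleGraph V) :
    Ideal (MvPolynomial V k) :=
  Ideal.span {p : MvPolynomial V k |
    ∃ u v : V, G.Adj u v ∧ p = MvPolynomial.X u * MvPolynomial.X v}

/-- The arithmetical rank of the edge ideal of `G`: the least `r` such that
there are `r` polynomials generating an ideal whose radical is `I(G)`. -/
noncomputable def ara (k : Type) [Field k] (G : SimpleGraph V) : ℕ :=
  sInf {r : ℕ | ∃ q : Fin r → MvPolynomial V k,
    (Ideal.span (Set.range q)).radical = edgeIdeal k G}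

/-- The cycles of `G` are pairwise vertex-disjoint: any two cycles sharing a
vertex have the same edge set (i.e. are the same cycle). -/
def CyclesPairwiseDisjoint (G : SimpleGraph V) : Prop :=
  ∀ ⦃u v : V⦄ (c : G.Walk u u) (d : G.Walk v v), c.IsCycle → d.IsCycle →
    (∃ w : V, w ∈ c.support ∧ w ∈ d.support) →
    ∀ e : Sym2 V, e ∈ c.edges ↔ e ∈ d.edges

section basics

/-- Subgraph induced on `U`, seen as a graph on the same vertex type. -/
def res (G : SimpleGraph V) (U : Set V) : SimpleGraph V where
  Adj u v := G.Adj u v ∧ u ∈ U ∧ v ∈ U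
  symm := ⟨fun u v h => ⟨h.1.symm, h.2.2, h.2.1⟩⟩
  loopless := ⟨fun u h => G.loopless.irrefl u h.1⟩

theorem res_adj {G : SimpleGraph V} {U : Set V} {u v : V} :
    (res G U).Adj u v ↔ G.Adj u v ∧ u ∈ U ∧ v ∈ U := Iff.rfl

theorem res_le (G : SimpleGraph V) (U : Set V) : res G U ≤ G := fun _ _ h => h.1

theorem res_res (G : SimpleGraph V) (U W : Set V) : res (res G U) W = res G (U ∩ W) := by
  ext u v; simp only [res_adj, Set.mem_inter_iff]; tauto

theorem res_univ (G : SimpleGraph V) : res G Set.univ = G := by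
  ext u v; simp [res_adj]

theorem res_mono {G H : SimpleGraph V} (h : H ≤ G) {U W : Set V} (hU : U ⊆ W) : res H U ≤ res G W :=
  fun _ _ ha => ⟨h ha.1, hU ha.2.1, hU ha.2.2⟩

/-- Neighbours of a set. -/
def nb (G : SimpleGraph V) (I : Set V) : Set V := {v | ∃ u ∈ I, G.Adj u v}

def Indep (G : SimpleGraph V) (I : Set V) : Prop := ∀ u ∈ I, ∀ v ∈ I, ¬ G.Adj u v

theorem isMinVC_iff (G : SimpleGraph V) (C : Set V) :
    IsMinVC G C ↔ IsVC G C ∧ ∀ c ∈ C, ∃ v, G.Adj c v ∧ v ∉ C := by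
  constructor
  · rintro ⟨h1, h2⟩
    refine ⟨h1, fun c hc => ?_⟩
    by_contra! hcon
    refine h2 (C \ {c}) ⟨Set.diff_subset, fun h => (h hc).2 rfl⟩ ?_
    intro u v huv
    have := h1 huv
    have hne := huv.ne
    by_cases hu : u = c
    · subst hu
      exact Or.inr ⟨hcon v huv, fun h => hne (by simpa using h.symm)⟩
    · by_cases hv : v = c
      · subst hv
        exact Or.inl ⟨hcon u huv.symm, fun h => hne (by simpa using h)⟩
      · rcases this with h | h
        · exact Or.inl ⟨h, by simpa using hu⟩
        · exact Or.inr ⟨h, by simpa using hv⟩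
  · rintro ⟨h1, h2⟩
    refine ⟨h1, fun D hD hvc => ?_⟩
    obtain ⟨c, hc, hcD⟩ := Set.exists_of_ssubset hD
    obtain ⟨v, hv, hvC⟩ := h2 c hc
    rcases hvc hv with h | h
    · exact hcD h
    · exact hvC (hD.1 h)

variable [Finite V]

theorem bddAbove_minVC (G : SimpleGraph V) :
    BddAbove {n : ℕ | ∃ C : Set V, IsMinVC G C ∧ C.ncard = n} := by
  refine ⟨Nat.card V, ?_⟩
  rintro n ⟨C, -, rfl⟩
  exact Set.ncard_le_card C

theorem exists_minVC_sub (G : SimpleGraph V) (C : Set V) (hC : IsVC G C) :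
    ∃ D, D ⊆ C ∧ IsMinVC G D := by
  obtain ⟨D, hDC, hD⟩ := (Set.toFinite {D | IsVC G D}).exists_le_minimal hC
  refine ⟨D, hDC, hD.1, fun E hE hvc => ?_⟩
  exact hE.2 (hD.2 hvc hE.1)

theorem bight_ge {G : SimpleGraph V} {I A : Set V} (hI : Indep G I) (hA : A ⊆ nb G I) :
    A.ncard ≤ bight G := by
  have hvc : IsVC G Iᶜ := by
    intro u v huv
    by_contra! h
    exact hI u (by simpa using h.1) v (by simpa using h.2) huv
  obtain ⟨D, hD, hmin⟩ := exists_minVC_sub G _ hvc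
  refine le_trans (Set.ncard_le_ncard (t := D) ?_ (Set.toFinite _))
    (le_csSup (bddAbove_minVC G) ⟨D, hmin, rfl⟩)
  intro a ha
  obtain ⟨u, hu, hua⟩ := hA ha
  rcases hmin.1 hua with h | h
  · exact absurd hu (hD h)
  · exact h

theorem exists_opt (G : SimpleGraph V) :
    ∃ I : Set V, Indep G I ∧ (nb G I).ncard = bight G ∧ ∀ v, v ∈ I ∨ v ∈ nb G I := by
  have hne : {n : ℕ | ∃ C : Set V, IsMinVC G C ∧ C.ncard = n}.Nonempty := by
    obtain ⟨D, -, hD⟩ := exists_minVC_sub G Set.univ (fun _ _ _ => Or.inl trivial)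
    exact ⟨_, D, hD, rfl⟩
  obtain ⟨C, hC, hcard⟩ := Nat.sSup_mem hne (bddAbove_minVC G)
  rw [isMinVC_iff] at hC
  have hnb : nb G Cᶜ = C := by
    ext v
    constructor
    · rintro ⟨u, hu, huv⟩
      exact (hC.1 huv).resolve_left hu
    · intro hv
      obtain ⟨u, hu, huC⟩ := hC.2 v hv
      exact ⟨u, huC, hu.symm⟩
  refine ⟨Cᶜ, ?_, ?_, ?_⟩
  · intro u hu v hv huv
    rcases hC.1 huv with h | h
    · exact hu h
    · exact hv h
  · rw [hnb]; exact hcard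
  · intro v; rw [hnb]; by_cases h : v ∈ C
    · exact Or.inr h
    · exact Or.inl h

theorem nb_res_sub (G : SimpleGraph V) (U I : Set V) : nb (res G U) I ⊆ U := by
  rintro v ⟨u, -, h⟩; exact h.2.2

/-- Optimal independent set inside `U`. -/
theorem exists_opt_res (G : SimpleGraph V) (U : Set V) :
    ∃ I ⊆ U, Indep G I ∧ (nb (res G U) I).ncard = bight (res G U) ∧
      ∀ v ∈ U, v ∈ I ∨ v ∈ nb (res G U) I := by
  obtain ⟨I, h1, h2, h3⟩ := exists_opt (res G U)
  have hnb : nb (res G U) (I ∩ U) = nb (res G U) I := by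
    ext v; constructor
    · rintro ⟨u, hu, huv⟩; exact ⟨u, hu.1, huv⟩
    · rintro ⟨u, hu, huv⟩; exact ⟨u, ⟨hu, huv.2.1⟩, huv⟩
  refine ⟨I ∩ U, Set.inter_subset_right, ?_, by rw [hnb]; exact h2, ?_⟩
  · intro u hu v hv huv
    exact h1 u hu.1 v hv.1 ⟨huv, hu.2, hv.2⟩
  · intro v hv
    rw [hnb]
    rcases h3 v with h | h
    · exact Or.inl ⟨h, hv⟩
    · exact Or.inr h

theorem bight_res_le (G : SimpleGraph V) (U : Set V) : bight (res G U) ≤ bight G := by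
  obtain ⟨I, hU, hI, hc, -⟩ := exists_opt_res G U
  rw [← hc]
  refine bight_ge hI ?_
  rintro v ⟨u, hu, huv⟩
  exact ⟨u, hu, huv.1⟩

theorem bight_split (G : SimpleGraph V) (U : Set V) (hU : ∀ u v, G.Adj u v → u ∈ U → v ∈ U) :
    bight G = bight (res G U) + bight (res G Uᶜ) := by
  apply le_antisymm
  · obtain ⟨I, hI, hc, -⟩ := exists_opt G
    have h1 : (nb G I ∩ U).ncard ≤ bight (res G U) := by
      refine bight_ge (I := I) (fun u hu v hv h => hI u hu v hv h.1) ?_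
      rintro v ⟨⟨u, hu, huv⟩, hv⟩
      exact ⟨u, hu, huv, hU v u huv.symm hv, hv⟩
    have h2 : (nb G I ∩ Uᶜ).ncard ≤ bight (res G Uᶜ) := by
      refine bight_ge (I := I) (fun u hu v hv h => hI u hu v hv h.1) ?_
      rintro v ⟨⟨u, hu, huv⟩, hv⟩
      exact ⟨u, hu, huv, fun h => hv (hU u v huv h), hv⟩
    have h3 := Set.ncard_inter_add_ncard_diff_eq_ncard (nb G I) U
    rw [Set.diff_eq] at h3
    omega
  · obtain ⟨I, hIU, hI, hc, -⟩ := exists_opt_res G U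
    obtain ⟨J, hJU, hJ, hc', -⟩ := exists_opt_res G Uᶜ
    rw [← hc, ← hc', ← Set.ncard_union_eq]
    · refine bight_ge (I := I ∪ J) ?_ ?_
      · rintro u (hu | hu) v (hv | hv) huv
        · exact hI u hu v hv huv
        · exact hJU hv (hU u v huv (hIU hu))
        · exact hJU hu (hU v u huv.symm (hIU hv))
        · exact hJ u hu v hv huv
      · rintro v (⟨u, hu, huv⟩ | ⟨u, hu, huv⟩)
        · exact ⟨u, Or.inl hu, huv.1⟩
        · exact ⟨u, Or.inr hu, huv.1⟩
    · rw [Set.disjoint_left]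
      intro v hv hv'
      exact nb_res_sub _ _ _ hv' (nb_res_sub _ _ _ hv)

/-- If an optimal set dominates `a`, then deleting `a` loses at most one. -/
theorem bight_del_of_mem_nb {G : SimpleGraph V} {I : Set V} (hI : Indep G I)
    (hc : (nb G I).ncard = bight G) {a : V} (ha : a ∈ nb G I) :
    bight G ≤ bight (res G {a}ᶜ) + 1 := by
  rw [← hc, ← Set.ncard_diff_singleton_add_one ha]
  refine Nat.add_le_add_right ?_ 1
  refine bight_ge (I := I) (fun u hu v hv h => hI u hu v hv h.1) ?_
  rintro v ⟨⟨u, hu, huv⟩, hv⟩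
  refine ⟨u, hu, huv, ?_, hv⟩
  rintro rfl
  obtain ⟨x, hx, hxa⟩ := ha
  exact hI x hx _ hu hxa

theorem LB {G D : SimpleGraph V} (hD : D ≤ G) (X Y : Set V) (hXY : ∀ y ∈ Y, y ∉ X)
    (hE : ∀ u v, G.Adj u v → D.Adj u v ∨ u ∈ X ∨ v ∈ X)
    (hX : ∀ x ∈ X, ∃ y ∈ Y, G.Adj x y)
    (hY : ∀ y ∈ Y, bight (res D (X ∪ {y})ᶜ) + 2 ≤ bight (res D Xᶜ)) :
    X.ncard + bight (res D Xᶜ) ≤ bight G := by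
  obtain ⟨I, hIU, hI, hc, hmax⟩ := exists_opt_res D Xᶜ
  have hYI : Y ⊆ I := by
    intro y hy
    rcases hmax y (hXY y hy) with h | h
    · exact h
    · exfalso
      have h1 := bight_del_of_mem_nb (G := res D Xᶜ)
        (fun u hu v hv h => hI u hu v hv h.1) hc h
      rw [res_res, ← Set.compl_union] at h1
      have := hY y hy
      omega
  rw [← hc, ← Set.ncard_union_eq]
  · refine bight_ge (I := I) ?_ ?_
    · intro u hu v hv huv
      rcases hE u v huv with h | h | h
      · exact hI u hu v hv h
      · exact hIU hu h
      · exact hIU hv h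
    · rintro v (hv | ⟨u, hu, huv⟩)
      · obtain ⟨y, hy, h⟩ := hX v hv
        exact ⟨y, hYI hy, h.symm⟩
      · exact ⟨u, hu, hD huv.1⟩
  · rw [Set.disjoint_left]
    intro v hv hv'
    exact nb_res_sub _ _ _ hv' hv

/-- The breaking lemma, case where the loss is zero. -/
theorem break_i {G : SimpleGraph V} {a b c : V} {U : Set V} (ha : a ∈ U) (hb : b ∉ U)
    (hab : G.Adj a b)
    (hE : ∀ u v, G.Adj u v → u ∈ U → v ∉ U → u = a ∧ (v = b ∨ v = c))
    (hs : bight (res G U) ≤ bight (res G (U \ {a}))) :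
    bight (G.deleteEdges {s(a, b)}) ≤ bight G := by
  obtain ⟨I, hI, hc, -⟩ := exists_opt (G.deleteEdges {s(a, b)})
  have hdel : ∀ u v, (G.deleteEdges {s(a, b)}).Adj u v ↔ G.Adj u v ∧ s(u, v) ≠ s(a, b) := by
    intro u v; rw [SimpleGraph.deleteEdges_adj]; simp
  by_cases hboth : a ∈ I ∧ b ∈ I
  swap
  · rw [← hc]
    refine bight_ge (I := I) ?_ ?_
    · intro u hu v hv huv
      refine hI u hu v hv ((hdel u v).2 ⟨huv, fun h => hboth ?_⟩)
      rcases Sym2.eq_iff.1 h with ⟨rfl, rfl⟩ | ⟨rfl, rfl⟩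
      · exact ⟨hu, hv⟩
      · exact ⟨hv, hu⟩
    · rintro v ⟨u, hu, huv⟩
      exact ⟨u, hu, ((hdel u v).1 huv).1⟩
  obtain ⟨haI, hbI⟩ := hboth
  obtain ⟨R, hRU, hR, hRc, -⟩ := exists_opt_res G (U \ {a})
  set N := nb (G.deleteEdges {s(a, b)}) I with hN
  have haN : a ∉ N := by
    rintro ⟨u, hu, h⟩; exact hI u hu a haI h
  have h1 : (N ∩ U).ncard ≤ bight (res G U) := by
    refine bight_ge (I := I ∩ U) ?_ ?_
    · intro u hu v hv huv
      refine hI u hu.1 v hv.1 ((hdel u v).2 ⟨huv.1, fun h => ?_⟩)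
      rcases Sym2.eq_iff.1 h with ⟨rfl, rfl⟩ | ⟨rfl, rfl⟩
      · exact hb hv.2
      · exact hb hu.2
    · rintro v ⟨⟨u, hu, huv⟩, hv⟩
      have huv' := ((hdel u v).1 huv).1
      have huU : u ∈ U := by
        by_contra huU
        have := (hE v u huv'.symm hv huU).1
        subst this
        exact haN ⟨u, hu, huv⟩
      exact ⟨u, ⟨hu, huU⟩, huv', huU, hv⟩
  have h2 : (nb (res G (U \ {a})) R ∪ {a} ∪ ((N \ U) \ {c})).ncard ≤ bight G := by
    refine bight_ge (I := R ∪ (I \ U)) ?_ ?_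
    · rintro u (hu | hu) v (hv | hv) huv
      · exact hR u hu v hv huv
      · exact (hRU hu).2 (hE u v huv (hRU hu).1 hv.2).1
      · exact (hRU hv).2 (hE v u huv.symm (hRU hv).1 hu.2).1
      · refine hI u hu.1 v hv.1 ((hdel u v).2 ⟨huv, fun h => ?_⟩)
        rcases Sym2.eq_iff.1 h with ⟨rfl, rfl⟩ | ⟨rfl, rfl⟩
        · exact hu.2 ha
        · exact hv.2 ha
    · rintro v ((⟨u, hu, huv⟩ | rfl) | ⟨⟨⟨u, hu, huv⟩, hvU⟩, hvc⟩)
      · exact ⟨u, Or.inl hu, huv.1⟩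
      · exact ⟨b, Or.inr ⟨hbI, hb⟩, hab.symm⟩
      · refine ⟨u, Or.inr ⟨hu, fun huU => ?_⟩, ((hdel u v).1 huv).1⟩
        obtain ⟨rfl, h | h⟩ := hE u v ((hdel u v).1 huv).1 huU hvU
        · subst h
          exact hI _ hu _ hbI huv
        · exact hvc h
  have hd1 : Disjoint (nb (res G (U \ {a})) R) {a} := by
    rw [Set.disjoint_singleton_right]
    intro h; exact (nb_res_sub _ _ _ h).2 rfl
  have hd2 : Disjoint (nb (res G (U \ {a})) R ∪ {a}) ((N \ U) \ {c}) := by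
    rw [Set.disjoint_left]
    rintro v (h | rfl) hv
    · exact hv.1.2 (nb_res_sub _ _ _ h).1
    · exact hv.1.2 ha
  rw [Set.ncard_union_eq hd2, Set.ncard_union_eq hd1, Set.ncard_singleton, hRc] at h2
  have h3 := Set.ncard_inter_add_ncard_diff_eq_ncard N U
  have h4 := Set.ncard_le_ncard_diff_add_ncard (N \ U) {c}
  rw [Set.ncard_singleton] at h4
  omega

theorem break_ii {G : SimpleGraph V} {a b c : V} {U W : Set V} (ha : a ∈ U) (hb : b ∉ U)
    (hab : G.Adj a b)
    (hE : ∀ u v, G.Adj u v → u ∈ U → v ∉ U → u = a ∧ (v = b ∨ v = c))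
    (hs : bight (res G U) ≤ bight (res G (U \ {a})) + 1)
    (hcW : c ∈ W) (hbW : b ∉ W) (hUW : Disjoint U W)
    (hEW : ∀ u v, G.Adj u v → u ∈ W → v ∉ W → u = c)
    (hsW : bight (res G (W \ {c})) + 1 ≤ bight (res G W)) :
    bight (G.deleteEdges {s(a, b)}) ≤ bight G := by
  obtain ⟨I, hI, hc, -⟩ := exists_opt (G.deleteEdges {s(a, b)})
  have hdel : ∀ u v, (G.deleteEdges {s(a, b)}).Adj u v ↔ G.Adj u v ∧ s(u, v) ≠ s(a, b) := by
    intro u v; rw [SimpleGraph.deleteEdges_adj]; simp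
  by_cases hboth : a ∈ I ∧ b ∈ I
  swap
  · rw [← hc]
    refine bight_ge (I := I) ?_ ?_
    · intro u hu v hv huv
      refine hI u hu v hv ((hdel u v).2 ⟨huv, fun h => hboth ?_⟩)
      rcases Sym2.eq_iff.1 h with ⟨rfl, rfl⟩ | ⟨rfl, rfl⟩
      · exact ⟨hu, hv⟩
      · exact ⟨hv, hu⟩
    · rintro v ⟨u, hu, huv⟩
      exact ⟨u, hu, ((hdel u v).1 huv).1⟩
  obtain ⟨haI, hbI⟩ := hboth
  obtain ⟨R, hRU, hR, hRc, -⟩ := exists_opt_res G (U \ {a})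
  set N := nb (G.deleteEdges {s(a, b)}) I with hN
  have haN : a ∉ N := by
    rintro ⟨u, hu, h⟩; exact hI u hu a haI h
  have h1 : (N ∩ U).ncard ≤ bight (res G U) := by
    refine bight_ge (I := I ∩ U) ?_ ?_
    · intro u hu v hv huv
      refine hI u hu.1 v hv.1 ((hdel u v).2 ⟨huv.1, fun h => ?_⟩)
      rcases Sym2.eq_iff.1 h with ⟨rfl, rfl⟩ | ⟨rfl, rfl⟩
      · exact hb hv.2
      · exact hb hu.2
    · rintro v ⟨⟨u, hu, huv⟩, hv⟩
      have huv' := ((hdel u v).1 huv).1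
      have huU : u ∈ U := by
        by_contra huU
        have := (hE v u huv'.symm hv huU).1
        subst this
        exact haN ⟨u, hu, huv⟩
      exact ⟨u, ⟨hu, huU⟩, huv', huU, hv⟩
  have hd1 : Disjoint (nb (res G (U \ {a})) R) {a} := by
    rw [Set.disjoint_singleton_right]
    intro h; exact (nb_res_sub _ _ _ h).2 rfl
  have h3 := Set.ncard_inter_add_ncard_diff_eq_ncard N U
  by_cases hcase : c ∈ N \ U → ∃ u ∈ I \ U, G.Adj u c
  · have h2 : (nb (res G (U \ {a})) R ∪ {a} ∪ (N \ U)).ncard ≤ bight G := by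
      refine bight_ge (I := R ∪ (I \ U)) ?_ ?_
      · rintro u (hu | hu) v (hv | hv) huv
        · exact hR u hu v hv huv
        · exact (hRU hu).2 (hE u v huv (hRU hu).1 hv.2).1
        · exact (hRU hv).2 (hE v u huv.symm (hRU hv).1 hu.2).1
        · refine hI u hu.1 v hv.1 ((hdel u v).2 ⟨huv, fun h => ?_⟩)
          rcases Sym2.eq_iff.1 h with ⟨rfl, rfl⟩ | ⟨rfl, rfl⟩
          · exact hu.2 ha
          · exact hv.2 ha
      · rintro v ((⟨u, hu, huv⟩ | rfl) | ⟨⟨u, hu, huv⟩, hvU⟩)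
        · exact ⟨u, Or.inl hu, huv.1⟩
        · exact ⟨b, Or.inr ⟨hbI, hb⟩, hab.symm⟩
        · by_cases hvc : v = c
          · subst hvc
            obtain ⟨x, hx, hxv⟩ := hcase ⟨⟨u, hu, huv⟩, hvU⟩
            exact ⟨x, Or.inr hx, hxv⟩
          refine ⟨u, Or.inr ⟨hu, fun huU => ?_⟩, ((hdel u v).1 huv).1⟩
          obtain ⟨rfl, h | h⟩ := hE u v ((hdel u v).1 huv).1 huU hvU
          · subst h
            exact hI _ hu _ hbI huv
          · exact hvc h
    have hd2 : Disjoint (nb (res G (U \ {a})) R ∪ {a}) (N \ U) := by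
      rw [Set.disjoint_left]
      rintro v (h | rfl) hv
      · exact hv.2 (nb_res_sub _ _ _ h).1
      · exact hv.2 ha
    rw [Set.ncard_union_eq hd2, Set.ncard_union_eq hd1, Set.ncard_singleton, hRc] at h2
    omega
  · push Not at hcase
    obtain ⟨hcN, hno⟩ := hcase
    have hcI : c ∉ I := by
      intro h
      obtain ⟨u, hu, huc⟩ := hcN.1
      exact hI u hu c h huc
    obtain ⟨R2, hR2U, hR2, hR2c, -⟩ := exists_opt_res G W
    have hW1 : (N ∩ W).ncard ≤ bight (res G (W \ {c})) + 1 := by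
      have h5 : ((N ∩ W) \ {c}).ncard ≤ bight (res G (W \ {c})) := by
        refine bight_ge (I := I ∩ W) ?_ ?_
        · intro u hu v hv huv
          refine hI u hu.1 v hv.1 ((hdel u v).2 ⟨huv.1, fun h => ?_⟩)
          rcases Sym2.eq_iff.1 h with ⟨rfl, rfl⟩ | ⟨rfl, rfl⟩
          · exact hbW hv.2
          · exact hbW hu.2
        · rintro v ⟨⟨⟨u, hu, huv⟩, hv⟩, hvc⟩
          have huv' := ((hdel u v).1 huv).1
          have huU : u ∈ W := by
            by_contra huU
            exact hvc (hEW v u huv'.symm hv huU)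
          refine ⟨u, ⟨hu, huU⟩, huv', ⟨huU, ?_⟩, hv, hvc⟩
          rintro rfl
          exact hcI hu
      have h4 := Set.ncard_le_ncard_diff_add_ncard (N ∩ W) {c}
      rw [Set.ncard_singleton] at h4
      omega
    have h2 : ((nb (res G (U \ {a})) R ∪ {a}) ∪ (nb (res G W) R2 ∪ ((N \ U) \ W))).ncard
        ≤ bight G := by
      refine bight_ge (I := R ∪ (R2 ∪ ((I \ U) \ W))) ?_ ?_
      · have k1 : ∀ u ∈ R, ∀ v, v ∉ U → ¬ G.Adj u v := fun u hu v hv huv =>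
          (hRU hu).2 (hE u v huv (hRU hu).1 hv).1
        have k2 : ∀ u ∈ R2, ∀ v ∈ (I \ U) \ W, ¬ G.Adj u v := by
          intro u hu v hv huv
          have := hEW u v huv (hR2U hu) hv.2
          subst this
          exact hno v hv.1 huv.symm
        have k3 : ∀ u ∈ R2, u ∉ U := fun u hu h => Set.disjoint_left.1 hUW h (hR2U hu)
        rintro u (hu | hu | hu) v (hv | hv | hv) huv
        · exact hR u hu v hv huv
        · exact k1 u hu v (k3 v hv) huv
        · exact k1 u hu v hv.1.2 huv
        · exact k1 v hv u (k3 u hu) huv.symm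
        · exact hR2 u hu v hv huv
        · exact k2 u hu v hv huv
        · exact k1 v hv u hu.1.2 huv.symm
        · exact k2 v hv u hu huv.symm
        · refine hI u hu.1.1 v hv.1.1 ((hdel u v).2 ⟨huv, fun h => ?_⟩)
          rcases Sym2.eq_iff.1 h with ⟨rfl, rfl⟩ | ⟨rfl, rfl⟩
          · exact hu.1.2 ha
          · exact hv.1.2 ha
      · rintro v ((⟨u, hu, huv⟩ | rfl) | (⟨u, hu, huv⟩ | ⟨⟨⟨u, hu, huv⟩, hvU⟩, hvW⟩))
        · exact ⟨u, Or.inl hu, huv.1⟩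
        · exact ⟨b, Or.inr (Or.inr ⟨⟨hbI, hb⟩, hbW⟩), hab.symm⟩
        · exact ⟨u, Or.inr (Or.inl hu), huv.1⟩
        · refine ⟨u, Or.inr (Or.inr ⟨⟨hu, fun huU => ?_⟩, fun huW => ?_⟩), ((hdel u v).1 huv).1⟩
          · obtain ⟨rfl, h | h⟩ := hE u v ((hdel u v).1 huv).1 huU hvU
            · subst h
              exact hI _ hu _ hbI huv
            · subst h; exact hvW hcW
          · have := hEW u v ((hdel u v).1 huv).1 huW hvW
            subst this
            exact hcI hu
    have hd2 : Disjoint (nb (res G W) R2) ((N \ U) \ W) := by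
      rw [Set.disjoint_left]
      intro v h hv
      exact hv.2 (nb_res_sub _ _ _ h)
    have hd3 : Disjoint (nb (res G (U \ {a})) R ∪ {a}) (nb (res G W) R2 ∪ ((N \ U) \ W)) := by
      have : ∀ v ∈ U, v ∉ nb (res G W) R2 ∪ ((N \ U) \ W) := by
        rintro v hv (h | h)
        · exact Set.disjoint_left.1 hUW hv (nb_res_sub _ _ _ h)
        · exact h.1.2 hv
      rw [Set.disjoint_left]
      rintro v (h | rfl)
      · exact this v (nb_res_sub _ _ _ h).1
      · exact this _ ha
    rw [Set.ncard_union_eq hd3, Set.ncard_union_eq hd1, Set.ncard_union_eq hd2,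
      Set.ncard_singleton, hRc, hR2c] at h2
    have h6 := Set.ncard_inter_add_ncard_diff_eq_ncard (N \ U) W
    have h7 : (N \ U) ∩ W = N ∩ W := by
      ext v; constructor
      · rintro ⟨h, h'⟩; exact ⟨h.1, h'⟩
      · rintro ⟨h, h'⟩; exact ⟨⟨h, fun hu => Set.disjoint_left.1 hUW hu h'⟩, h'⟩
    rw [h7] at h6
    omega

end basics

section algebra

/-- The number of cycles. -/
noncomputable def nc (G : SimpleGraph V) : ℕ :=
  Set.ncard {s : Set (Sym2 V) |
        ∃ (u : V) (c : G.Walk u u), c.IsCycle ∧ s = {e | e ∈ c.edges}}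

def GIn {k : Type} [Field k] (G : SimpleGraph V) (P : Ideal (MvPolynomial V k)) : Prop :=
  ∀ u v, G.Adj u v → (MvPolynomial.X u * MvPolynomial.X v : MvPolynomial V k) ∈ P

def Rad {k : Type} [Field k] (G : SimpleGraph V) (q : MvPolynomial V k) : Prop :=
  ∀ P : Ideal (MvPolynomial V k), P.IsPrime → GIn G P → q ∈ P

variable {k : Type} [Field k]

theorem GIn.mono {G H : SimpleGraph V} (h : H ≤ G) {P : Ideal (MvPolynomial V k)} (hP : GIn G P) :
    GIn H P := fun u v huv => hP u v (h huv)

theorem Rad.mono {G H : SimpleGraph V} (h : H ≤ G) {q : MvPolynomial V k} (hq : Rad H q) :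
    Rad G q := fun P hP hG => hq P hP (hG.mono h)

theorem rad_zero (G : SimpleGraph V) : Rad G (0 : MvPolynomial V k) := fun P _ _ => P.zero_mem

theorem rad_edge {G : SimpleGraph V} {u v : V} (h : G.Adj u v) :
    Rad G (MvPolynomial.X u * MvPolynomial.X v : MvPolynomial V k) := fun _ _ hP => hP u v h

theorem Rad.add {G : SimpleGraph V} {p q : MvPolynomial V k} (hp : Rad G p) (hq : Rad G q) :
    Rad G (p + q) := fun P h1 h2 => P.add_mem (hp P h1 h2) (hq P h1 h2)

variable (k) in
/-- The slot form of the main claim. -/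
def Slot (G : SimpleGraph V) (w : V) : Prop :=
  ∃ (S : Finset (MvPolynomial V k)) (l : ℕ → MvPolynomial V k),
    (∀ q ∈ S, Rad G q) ∧ (∀ j, Rad G (l j)) ∧ S.card ≤ bight (res G {w}ᶜ) + nc G ∧
    ∀ P : Ideal (MvPolynomial V k), P.IsPrime → (∀ q ∈ S, q ∈ P) →
      (MvPolynomial.X w ∈ P ∨ ∀ j < bight G - bight (res G {w}ᶜ), l j ∈ P) → GIn G P

theorem Slot.mk' [Finite V] {G : SimpleGraph V} {w : V} (S L : Finset (MvPolynomial V k))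
    (hS : ∀ q ∈ S, Rad G q) (hL : ∀ q ∈ L, Rad G q)
    (h1 : S.card ≤ bight (res G {w}ᶜ) + nc G) (h2 : S.card + L.card ≤ bight G + nc G)
    (hw : ∀ P : Ideal (MvPolynomial V k), P.IsPrime → (∀ q ∈ S, q ∈ P) →
      MvPolynomial.X w ∈ P → GIn G P)
    (hl : ∀ P : Ideal (MvPolynomial V k), P.IsPrime → (∀ q ∈ S, q ∈ P) →
      (∀ q ∈ L, q ∈ P) → GIn G P) : Slot k G w := by
  classical
  have hle := bight_res_le G {w}ᶜ
  obtain ⟨L1, hL1, hc1⟩ := Finset.exists_subset_card_eq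
    (s := L) (n := min L.card (bight G - bight (res G {w}ᶜ))) (min_le_left _ _)
  let g : ℕ → MvPolynomial V k := fun j =>
    if h : j < L1.card then (L1.equivFin.symm ⟨j, h⟩ : MvPolynomial V k) else 0
  refine ⟨S ∪ (L \ L1), g, ?_, ?_, ?_, ?_⟩
  · intro q hq
    rcases Finset.mem_union.1 hq with h | h
    · exact hS q h
    · exact hL q (Finset.mem_sdiff.1 h).1
  · intro j
    by_cases h : j < L1.card
    · simp only [g, h, dif_pos]
      exact hL _ (hL1 (L1.equivFin.symm ⟨j, h⟩).2)
    · simp only [g, h, dif_neg, not_false_iff]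
      exact rad_zero G
  · have := Finset.card_union_le S (L \ L1)
    have h3 := Finset.card_sdiff_of_subset hL1
    rw [hc1] at h3
    omega
  · intro P hP hq hor
    have hSP : ∀ q ∈ S, q ∈ P := fun q h => hq q (Finset.mem_union_left _ h)
    rcases hor with h | h
    · exact hw P hP hSP h
    · refine hl P hP hSP fun q hqL => ?_
      by_cases hq1 : q ∈ L1
      · have hj := (L1.equivFin ⟨q, hq1⟩).2
        have h4 := h (L1.equivFin ⟨q, hq1⟩) (by omega)
        simp only [g, hj, dif_pos] at h4
        simpa using h4
      · exact hq q (Finset.mem_union_right _ (Finset.mem_sdiff.2 ⟨hqL, hq1⟩))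

theorem Slot.total [Finite V] {G : SimpleGraph V} {w : V} (h : Slot k G w) :
    ∃ Q : Finset (MvPolynomial V k), (∀ q ∈ Q, Rad G q) ∧ Q.card ≤ bight G + nc G ∧
    ∀ P : Ideal (MvPolynomial V k), P.IsPrime → (∀ q ∈ Q, q ∈ P) → GIn G P := by
  classical
  obtain ⟨S, l, h1, h2, h3, h4⟩ := h
  have hle := bight_res_le G {w}ᶜ
  refine ⟨S ∪ (Finset.range (bight G - bight (res G {w}ᶜ))).image l, ?_, ?_, ?_⟩
  · intro q hq
    rcases Finset.mem_union.1 hq with h | h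
    · exact h1 q h
    · obtain ⟨j, -, rfl⟩ := Finset.mem_image.1 h
      exact h2 j
  · have a := Finset.card_union_le S ((Finset.range (bight G - bight (res G {w}ᶜ))).image l)
    have b := Finset.card_image_le (s := Finset.range (bight G - bight (res G {w}ᶜ))) (f := l)
    rw [Finset.card_range] at b
    omega
  · intro P hP hq
    refine h4 P hP (fun q h => hq q (Finset.mem_union_left _ h)) (Or.inr fun j hj => ?_)
    exact hq _ (Finset.mem_union_right _ (Finset.mem_image_of_mem _ (Finset.mem_range.2 hj)))

/-- Elementary symmetric sums. -/
noncomputable def esy {ι : Type} (s : Finset ι) (f : ι → MvPolynomial V k) (l : ℕ) :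
    MvPolynomial V k := ∑ t ∈ s.powersetCard l, ∏ i ∈ t, f i

theorem esy_rad {G : SimpleGraph V} {ι : Type} (s : Finset ι) (f : ι → MvPolynomial V k) (l : ℕ)
    (hl : 1 ≤ l) (hf : ∀ i ∈ s, Rad G (f i)) : Rad G (esy s f l) := by
  intro P hP hG
  refine P.sum_mem fun t ht => ?_
  obtain ⟨hts, hc⟩ := Finset.mem_powersetCard.1 ht
  obtain ⟨i, hi⟩ := Finset.card_pos.1 (by omega : 0 < t.card)
  exact P.mem_of_dvd (Finset.dvd_prod_of_mem f hi) (hf i (hts hi) P hP hG)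

theorem esy_all {ι : Type} (s : Finset ι) (f : ι → MvPolynomial V k)
    (P : Ideal (MvPolynomial V k)) (hP : P.IsPrime) (A : Finset ι) (hA : A ⊆ s)
    (hout : ∀ i ∈ s, i ∉ A → f i ∈ P)
    (hes : ∀ l, 1 ≤ l → l ≤ A.card → esy s f l ∈ P) : ∀ i ∈ s, f i ∈ P := by
  classical
  set N := s.filter (fun i => f i ∉ P) with hN
  have hNA : N ⊆ A := by
    intro i hi
    obtain ⟨h1, h2⟩ := Finset.mem_filter.1 hi
    by_contra h
    exact h2 (hout i h1 h)
  by_cases hne : N.card = 0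
  · intro i hi
    by_contra h
    have : i ∈ N := Finset.mem_filter.2 ⟨hi, h⟩
    rw [Finset.card_eq_zero.1 hne] at this
    simp at this
  · exfalso
    have h1 := hes N.card (by omega) (Finset.card_le_card hNA)
    have hmem : N ∈ s.powersetCard N.card :=
      Finset.mem_powersetCard.2 ⟨Finset.filter_subset _ _, rfl⟩
    rw [esy, ← Finset.add_sum_erase _ _ hmem] at h1
    have h2 : ∑ t ∈ (s.powersetCard N.card).erase N, ∏ i ∈ t, f i ∈ P := by
      refine P.sum_mem fun t ht => ?_
      obtain ⟨hne, ht⟩ := Finset.mem_erase.1 ht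
      obtain ⟨hts, hc⟩ := Finset.mem_powersetCard.1 ht
      have : ¬ t ⊆ N := fun h => hne (Finset.eq_of_subset_of_card_le h (by omega))
      obtain ⟨i, hi, hiN⟩ := Finset.not_subset.1 this
      have hfi : f i ∈ P := by
        by_contra h
        exact hiN (Finset.mem_filter.2 ⟨hts hi, h⟩)
      exact P.mem_of_dvd (Finset.dvd_prod_of_mem f hi) hfi
    have h3 := (P.add_mem_iff_left h2).1 h1
    obtain ⟨i, hi, hfi⟩ := (hP.prod_mem_iff (s := N) (x := f)).1 h3
    exact (Finset.mem_filter.1 hi).2 hfi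

theorem mem_ker_mem_span (C : Set V) [DecidablePred (· ∈ C)] (f : MvPolynomial V k)
    (hf : MvPolynomial.aeval (fun v => if v ∈ C then (0 : MvPolynomial V k) else MvPolynomial.X v) f
      = 0) : f ∈ Ideal.span (MvPolynomial.X '' C : Set (MvPolynomial V k)) := by
  set I := Ideal.span (MvPolynomial.X '' C : Set (MvPolynomial V k)) with hI
  set φ : MvPolynomial V k →ₐ[k] MvPolynomial V k :=
    MvPolynomial.aeval (fun v => if v ∈ C then (0 : MvPolynomial V k) else MvPolynomial.X v)
  have h : (Ideal.Quotient.mkₐ k I).comp φ = Ideal.Quotient.mkₐ k I := by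
    apply MvPolynomial.algHom_ext
    intro v
    by_cases hv : v ∈ C
    · have : (MvPolynomial.X v : MvPolynomial V k) ∈ I := Ideal.subset_span ⟨v, hv, rfl⟩
      simp [φ, hv, Ideal.Quotient.eq_zero_iff_mem.2 this]
    · simp [φ, hv]
  have h2 := congrArg (fun g => g f) h
  simp only [AlgHom.comp_apply] at h2
  rw [hf, map_zero] at h2
  exact Ideal.Quotient.eq_zero_iff_mem.1 h2.symm

theorem edgeIdeal_le_iff (G : SimpleGraph V) (P : Ideal (MvPolynomial V k)) :
    edgeIdeal k G ≤ P ↔ GIn G P := by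
  rw [edgeIdeal, Ideal.span_le]
  constructor
  · intro h u v huv
    exact h ⟨u, v, huv, rfl⟩
  · rintro h p ⟨u, v, huv, rfl⟩
    exact h u v huv

theorem rad_mem_edgeIdeal (G : SimpleGraph V) (q : MvPolynomial V k) (hq : Rad G q) :
    q ∈ edgeIdeal k G := by
  classical
  have hset : {p : MvPolynomial V k |
      ∃ u v : V, G.Adj u v ∧ p = MvPolynomial.X u * MvPolynomial.X v} =
      (fun s => MvPolynomial.monomial s (1 : k)) ''
        {s | ∃ u v : V, G.Adj u v ∧ s = Finsupp.single u 1 + Finsupp.single v 1} := by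
    ext p
    constructor
    · rintro ⟨u, v, h, rfl⟩
      refine ⟨_, ⟨u, v, h, rfl⟩, ?_⟩
      simp [MvPolynomial.X, MvPolynomial.monomial_mul]
    · rintro ⟨_, ⟨u, v, h, rfl⟩, rfl⟩
      refine ⟨u, v, h, ?_⟩
      simp [MvPolynomial.X, MvPolynomial.monomial_mul]
  rw [edgeIdeal, hset, MvPolynomial.mem_ideal_span_monomial_image]
  intro m hm
  by_contra! hcon
  let C : Set V := {v | m v = 0}
  set φ : MvPolynomial V k →ₐ[k] MvPolynomial V k :=
    MvPolynomial.aeval (fun v => if v ∈ C then (0 : MvPolynomial V k) else MvPolynomial.X v) with hφ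
  have hP : (RingHom.ker φ).IsPrime := RingHom.ker_isPrime _
  have hG : GIn G (RingHom.ker φ) := by
    intro u v huv
    rw [RingHom.mem_ker, map_mul]
    by_cases hu : u ∈ C
    · simp [hφ, hu]
    · by_cases hv : v ∈ C
      · simp [hφ, hv]
      · exfalso
        refine hcon _ ⟨u, v, huv, rfl⟩ ?_
        intro x
        have hne := huv.ne
        simp only [C, Set.mem_setOf_eq] at hu hv
        simp only [Finsupp.add_apply, Finsupp.single_apply]
        split_ifs with h1 h2 h2
        · exact absurd (h1.trans h2.symm) hne
        · subst h1; omega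
        · subst h2; omega
        · omega
  have h1 := mem_ker_mem_span C q (RingHom.mem_ker.1 (hq _ hP hG))
  obtain ⟨i, hi, hi'⟩ := MvPolynomial.mem_ideal_span_X_image.1 h1 m hm
  exact hi' hi

theorem ara_le (G : SimpleGraph V) (Q : Finset (MvPolynomial V k)) (hQ : ∀ q ∈ Q, Rad G q)
    (h : ∀ P : Ideal (MvPolynomial V k), P.IsPrime → (∀ q ∈ Q, q ∈ P) → GIn G P) :
    ara k G ≤ Q.card := by
  refine Nat.sInf_le ⟨fun i => (Q.equivFin.symm i : MvPolynomial V k), ?_⟩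
  have hr : Set.range (fun i => (Q.equivFin.symm i : MvPolynomial V k)) = (Q : Set _) := by
    ext x
    constructor
    · rintro ⟨i, rfl⟩; exact (Q.equivFin.symm i).2
    · intro hx; exact ⟨Q.equivFin ⟨x, hx⟩, by simp⟩
  rw [hr]
  apply le_antisymm
  · have : (edgeIdeal k G).radical ≤ edgeIdeal k G := by
      intro f hf
      apply rad_mem_edgeIdeal
      intro P hP hG
      exact (hP.radical_le_iff.2 ((edgeIdeal_le_iff G P).2 hG)) hf
    refine le_trans (Ideal.radical_mono ?_) this
    rw [Ideal.span_le]
    intro q hq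
    exact rad_mem_edgeIdeal G q (hQ q hq)
  · rw [Ideal.radical_eq_sInf]
    refine le_sInf ?_
    rintro P ⟨h1, h2⟩
    exact (edgeIdeal_le_iff G P).2 (h P h2 fun q hq => h1 (Ideal.subset_span hq))

end algebra

section cycles

def cycSet (G : SimpleGraph V) : Set (Set (Sym2 V)) :=
  {s | ∃ (u : V) (c : G.Walk u u), c.IsCycle ∧ s = {e | e ∈ c.edges}}

theorem nc_eq (G : SimpleGraph V) : nc G = (cycSet G).ncard := rfl

theorem cycSet_mono {G H : SimpleGraph V} (h : H ≤ G) : cycSet H ⊆ cycSet G := by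
  rintro s ⟨u, c, hc, rfl⟩
  exact ⟨u, c.mapLe h, hc.mapLe h, by simp only [Walk.edges_mapLe_eq_edges]⟩

theorem cycSet_nonempty {G : SimpleGraph V} {s : Set (Sym2 V)} (hs : s ∈ cycSet G) :
    ∃ e ∈ s, e ∈ G.edgeSet := by
  obtain ⟨u, c, hc, rfl⟩ := hs
  have : c.edges ≠ [] := fun h => hc.not_nil (Walk.edges_eq_nil.1 h)
  obtain ⟨e, he⟩ := List.exists_mem_of_ne_nil _ this
  exact ⟨e, he, c.edges_subset_edgeSet he⟩

theorem cycSet_sub {G : SimpleGraph V} {s : Set (Sym2 V)} (hs : s ∈ cycSet G) :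
    s ⊆ G.edgeSet := by
  obtain ⟨u, c, hc, rfl⟩ := hs
  exact fun e he => c.edges_subset_edgeSet he

theorem CPD.mono {G H : SimpleGraph V} (h : H ≤ G) (hG : CyclesPairwiseDisjoint G) :
    CyclesPairwiseDisjoint H := by
  intro u v c d hc hd ⟨w, hw1, hw2⟩ e
  have := hG (c.mapLe h) (d.mapLe h) (hc.mapLe h) (hd.mapLe h)
    ⟨w, by simpa using hw1, by simpa using hw2⟩ e
  simpa only [Walk.edges_mapLe_eq_edges] using this

variable [Finite V]

theorem nc_mono {G H : SimpleGraph V} (h : H ≤ G) : nc H ≤ nc G :=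
  Set.ncard_le_ncard (cycSet_mono h) (Set.toFinite _)

theorem nc_add {G H T : SimpleGraph V} (h : H ≤ G) (h' : T ≤ G)
    (hd : ∀ u v, H.Adj u v → ¬ T.Adj u v) : nc H + nc T ≤ nc G := by
  rw [nc_eq, nc_eq, nc_eq, ← Set.ncard_union_eq]
  · exact Set.ncard_le_ncard (Set.union_subset (cycSet_mono h) (cycSet_mono h')) (Set.toFinite _)
  · rw [Set.disjoint_left]
    intro s hs hs'
    obtain ⟨e, he, heH⟩ := cycSet_nonempty hs
    have heT := cycSet_sub hs' he
    induction e with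
    | _ u v => exact hd u v heH heT

theorem nc_del {G D : SimpleGraph V} (h : D ≤ G) {s : Set (Sym2 V)} (hs : s ∈ cycSet G)
    {e : Sym2 V} (he : e ∈ s) (heD : e ∉ D.edgeSet) : nc D + 1 ≤ nc G := by
  have hns : s ∉ cycSet D := fun h => heD (cycSet_sub h he)
  rw [nc_eq, nc_eq, ← Set.ncard_insert_of_notMem hns (Set.toFinite _)]
  exact Set.ncard_le_ncard (Set.insert_subset hs (cycSet_mono h)) (Set.toFinite _)

theorem edges_lt {G H : SimpleGraph V} (h : H ≤ G) {u v : V} (h1 : G.Adj u v) (h2 : ¬ H.Adj u v) :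
    H.edgeSet.ncard < G.edgeSet.ncard := by
  refine Set.ncard_lt_ncard ⟨edgeSet_subset_edgeSet.2 h, fun hh => h2 ?_⟩ (Set.toFinite _)
  exact hh (show s(u, v) ∈ G.edgeSet from h1)

theorem reach_closed (D : SimpleGraph V) (a : V) :
    ∀ u v, D.Adj u v → u ∈ {x | D.Reachable a x} → v ∈ {x | D.Reachable a x} :=
  fun _ _ huv hu => hu.trans huv.reachable

theorem F1 {G : SimpleGraph V} (hG : CyclesPairwiseDisjoint G) {w : V} (c : G.Walk w w)
    (hc : c.IsCycle) {a b : V} (ha : a ∈ c.support) (hb : b ∈ c.support) (hab : a ≠ b) :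
    ¬ (G.deleteEdges {e | e ∈ c.edges}).Reachable a b := by
  classical
  intro hr
  obtain ⟨p, hp⟩ := hr.exists_isPath
  cases p with
  | nil => exact hab rfl
  | @cons _ x _ h p =>
    rw [Walk.cons_isPath_iff] at hp
    have hax := (SimpleGraph.deleteEdges_adj.1 h)
    have hnb : ¬ G.IsBridge s(a, x) := by
      rw [isBridge_iff, not_not]
      have hcG : ∀ e ∈ c.edges, e ∈ (G.deleteEdges {s(a, x)}).edgeSet := by
        intro e he
        rw [edgeSet_deleteEdges]
        refine ⟨c.edges_subset_edgeSet he, ?_⟩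
        rintro rfl
        exact hax.2 he
      have hpG : ∀ e ∈ p.edges, e ∈ (G.deleteEdges {s(a, x)}).edgeSet := by
        intro e he
        rw [edgeSet_deleteEdges]
        refine ⟨edgeSet_subset_edgeSet.2 (deleteEdges_le _) (p.edges_subset_edgeSet he), ?_⟩
        rintro rfl
        exact hp.2 (p.fst_mem_support_of_mem_edges he)
      have r1 : (G.deleteEdges {s(a, x)}).Reachable x b := (p.transfer _ hpG).reachable
      have r2 : ∀ y ∈ c.support, (G.deleteEdges {s(a, x)}).Reachable w y := by
        intro y hy
        have hy' : y ∈ (c.transfer _ hcG).support := by rwa [Walk.support_transfer]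
        exact ((c.transfer _ hcG).takeUntil y hy').reachable
      exact ((r2 a ha).symm.trans (r2 b hb)).trans r1.symm
    rw [isBridge_iff_forall_cycle_notMem hax.1] at hnb
    push Not at hnb
    obtain ⟨u, d, hd, hed⟩ := hnb
    exact hax.2 ((hG c d hc hd ⟨a, ha, d.fst_mem_support_of_mem_edges hed⟩ _).2 hed)

/-- The combinatorial data of a cycle `v 0, …, v (m-1), v m = v 0` of `G`, with `D` the graph
obtained by deleting the edges of the cycle. -/
structure CycData (G D : SimpleGraph V) (m : ℕ) (v : ℕ → V) : Prop where
  hm : 3 ≤ m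
  h0 : v m = v 0
  inj : ∀ i < m, ∀ j < m, v i = v j → i = j
  adj : ∀ i < m, G.Adj (v i) (v (i + 1))
  le : D ≤ G
  edge : ∀ x y, G.Adj x y → D.Adj x y ∨ ∃ i < m, s(v i, v (i + 1)) = s(x, y)
  notD : ∀ i < m, ¬ D.Adj (v i) (v (i + 1))
  sep : ∀ i < m, ∀ j < m, i ≠ j → ¬ D.Reachable (v i) (v j)
  ncD : nc D + 1 ≤ nc G
  nce : ∀ i < m, nc (G.deleteEdges {s(v i, v (i + 1))}) + 1 ≤ nc G

theorem exists_cycData {G : SimpleGraph V} (hG : CyclesPairwiseDisjoint G) {w : V}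
    (c : G.Walk w w) (hc : c.IsCycle) :
    ∃ D m v, CycData G D m v ∧ v 0 = w := by
  have hm := hc.three_le_length
  have hinj : ∀ i < c.length, ∀ j < c.length, c.getVert i = c.getVert j → i = j := by
    intro i hi j hj h
    exact hc.getVert_injOn' (by simp; omega) (by simp; omega) h
  have hmem : ∀ i < c.length, s(c.getVert i, c.getVert (i + 1)) ∈ c.edges := fun i hi =>
    (Walk.mk_mem_edges_iff_exists _).2 ⟨i, hi, rfl⟩
  refine ⟨G.deleteEdges {e | e ∈ c.edges}, c.length, c.getVert, ⟨hm, ?_, hinj, ?_, ?_, ?_, ?_, ?_,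
    ?_, ?_⟩, c.getVert_zero⟩
  · rw [c.getVert_length, c.getVert_zero]
  · intro i hi; exact c.adj_getVert_succ hi
  · exact deleteEdges_le _
  · intro x y hxy
    by_cases h : s(x, y) ∈ c.edges
    · exact Or.inr ((Walk.mk_mem_edges_iff_exists _).1 h)
    · exact Or.inl (SimpleGraph.deleteEdges_adj.2 ⟨hxy, h⟩)
  · intro i hi h
    exact (SimpleGraph.deleteEdges_adj.1 h).2 (hmem i hi)
  · intro i hi j hj hij
    exact F1 hG c hc (c.getVert_mem_support i) (c.getVert_mem_support j)
      (fun h => hij (hinj i hi j hj h))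
  · refine nc_del (deleteEdges_le _) (s := {e | e ∈ c.edges}) ⟨w, c, hc, rfl⟩ (hmem 0 (by omega)) ?_
    rw [edgeSet_deleteEdges]
    exact fun h => h.2 (hmem 0 (by omega))
  · intro i hi
    refine nc_del (deleteEdges_le _) (s := {e | e ∈ c.edges}) ⟨w, c, hc, rfl⟩ (hmem i hi) ?_
    rw [edgeSet_deleteEdges]
    exact fun h => h.2 rfl

/-- Structure of a graph along an edge lying on no cycle. -/
theorem bridge_struct {G : SimpleGraph V} {w z : V} (h : G.Adj w z)
    (hno : ∀ (u : V) (c : G.Walk u u), c.IsCycle → s(w, z) ∉ c.edges) :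
    ∃ U : Set V, z ∈ U ∧ w ∉ U ∧ ∀ u v, G.Adj u v → u ∈ U → v ∉ U → u = z ∧ v = w := by
  have hb : G.IsBridge s(w, z) := (isBridge_iff_forall_cycle_notMem h).2 hno
  rw [isBridge_iff] at hb
  refine ⟨{x | (G.deleteEdges {s(w, z)}).Reachable z x}, Reachable.refl _, fun h => hb h.symm, ?_⟩
  intro u v huv hu hv
  by_cases he : s(u, v) = s(w, z)
  · rcases Sym2.eq_iff.1 he with ⟨rfl, rfl⟩ | ⟨rfl, rfl⟩
    · exact absurd (Reachable.refl _) hv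
    · exact ⟨rfl, rfl⟩
  · exact absurd (reach_closed _ z u v (SimpleGraph.deleteEdges_adj.2 ⟨huv, he⟩) hu) hv

theorem mem_edge_of_support {G : SimpleGraph V} {w : V} (c : G.Walk w w) (hc : c.IsCycle) {z : V}
    (hz : z ∈ c.support) : ∃ d : G.Walk z z, d.IsCycle := by
  classical
  exact ⟨c.rotate z hz, hc.rotate hz⟩

end cycles

section steps

variable [Finite V] {k : Type} [Field k]

theorem Slot.fin {G : SimpleGraph V} {w : V} (h : Slot k G w) :
    ∃ S L : Finset (MvPolynomial V k), (∀ q ∈ S, Rad G q) ∧ (∀ q ∈ L, Rad G q) ∧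
    S.card ≤ bight (res G {w}ᶜ) + nc G ∧ S.card + L.card ≤ bight G + nc G ∧
    (∀ P : Ideal (MvPolynomial V k), P.IsPrime → (∀ q ∈ S, q ∈ P) →
      MvPolynomial.X w ∈ P → GIn G P) ∧
    (∀ P : Ideal (MvPolynomial V k), P.IsPrime → (∀ q ∈ S, q ∈ P) →
      (∀ q ∈ L, q ∈ P) → GIn G P) := by
  classical
  obtain ⟨S, l, h1, h2, h3, h4⟩ := h
  have hle := bight_res_le G {w}ᶜ
  refine ⟨S, (Finset.range (bight G - bight (res G {w}ᶜ))).image l, h1, ?_, h3, ?_, ?_, ?_⟩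
  · intro q h
    obtain ⟨j, -, rfl⟩ := Finset.mem_image.1 h
    exact h2 j
  · have b := Finset.card_image_le (s := Finset.range (bight G - bight (res G {w}ᶜ))) (f := l)
    rw [Finset.card_range] at b
    omega
  · intro P hP hS hw
    exact h4 P hP hS (Or.inl hw)
  · intro P hP hS hL
    refine h4 P hP hS (Or.inr fun j hj => ?_)
    exact hL _ (Finset.mem_image_of_mem _ (Finset.mem_range.2 hj))

theorem slot_bridge {G : SimpleGraph V} {w z : V} {U : Set V} (hwz : G.Adj w z)
    (hz : z ∈ U) (hw : w ∉ U)
    (hE : ∀ u v, G.Adj u v → u ∈ U → v ∉ U → u = z ∧ v = w)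
    (hH : Slot k (res G Uᶜ) w) (hT : Slot k (res G U) z)
    (hs2 : bight (res G (U ∩ {z}ᶜ)) + 1 ≤ bight (res G U))
    (hs : bight (res G {w}ᶜ) + 1 ≤ bight G) : Slot k G w := by
  classical
  obtain ⟨S1, l1, hr1, hl1, hc1, hp1⟩ := hH
  obtain ⟨S2, l2, hr2, hl2, hc2, hp2⟩ := hT
  rw [res_res] at hc1 hc2 hp1 hp2
  set bH := bight (res G Uᶜ)
  set bHw := bight (res G (Uᶜ ∩ {w}ᶜ))
  set bT := bight (res G U)
  set bTz := bight (res G (U ∩ {z}ᶜ))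
  have hnc : nc (res G Uᶜ) + nc (res G U) ≤ nc G :=
    nc_add (res_le _ _) (res_le _ _) (fun u v h h' => h.2.1 h'.2.1)
  have hGw : bight (res G {w}ᶜ) = bT + bHw := by
    rw [bight_split (res G {w}ᶜ) U, res_res, res_res]
    · have e1 : ({w}ᶜ ∩ U : Set V) = U := by
        ext x; constructor
        · exact fun h => h.2
        · exact fun h => ⟨fun hx => hw (by rw [← (hx : x = w)]; exact h), h⟩
      rw [e1, Set.inter_comm]
    · intro u v huv hu
      by_contra hv
      exact huv.2.2 (hE u v huv.1 hu hv).2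
  have hbig : bHw + 2 ≤ bH → bH + bTz + 1 ≤ bight G := by
    intro h2
    obtain ⟨I, hIU, hI, hIc, hImax⟩ := exists_opt_res G Uᶜ
    obtain ⟨J, hJU, hJ, hJc, -⟩ := exists_opt_res G (U ∩ {z}ᶜ)
    have hwI : w ∈ I := by
      rcases hImax w hw with h | h
      · exact h
      · exfalso
        have h1 := bight_del_of_mem_nb (G := res G Uᶜ)
          (fun u hu v hv h => hI u hu v hv h.1) hIc h
        rw [res_res] at h1
        omega
    have hd1 : Disjoint (nb (res G (U ∩ {z}ᶜ)) J) {z} := by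
      rw [Set.disjoint_singleton_right]
      exact fun h => (nb_res_sub _ _ _ h).2 rfl
    have hd2 : Disjoint (nb (res G Uᶜ) I) (nb (res G (U ∩ {z}ᶜ)) J ∪ {z}) := by
      rw [Set.disjoint_right]
      rintro x (hx | rfl) h
      · exact nb_res_sub _ _ _ h (nb_res_sub _ _ _ hx).1
      · exact nb_res_sub _ _ _ h hz
    have h3 : (nb (res G Uᶜ) I ∪ (nb (res G (U ∩ {z}ᶜ)) J ∪ {z})).ncard ≤ bight G := by
      refine bight_ge (I := I ∪ J) ?_ ?_
      · have k1 : ∀ u ∈ I, ∀ v ∈ J, ¬ G.Adj u v := by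
          intro u hu v hv huv
          exact (hJU hv).2 (hE v u huv.symm (hJU hv).1 (hIU hu)).1
        rintro u (hu | hu) v (hv | hv) huv
        · exact hI u hu v hv huv
        · exact k1 u hu v hv huv
        · exact k1 v hv u hu huv.symm
        · exact hJ u hu v hv huv
      · rintro v (⟨u, hu, huv⟩ | ⟨u, hu, huv⟩ | rfl)
        · exact ⟨u, Or.inl hu, huv.1⟩
        · exact ⟨u, Or.inr hu, huv.1⟩
        · exact ⟨w, Or.inl hwI, hwz⟩
    rw [Set.ncard_union_eq hd2, Set.ncard_union_eq hd1, Set.ncard_singleton, hIc, hJc] at h3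
    omega
  have hHle : bHw ≤ bH := by
    have := bight_res_le (res G Uᶜ) {w}ᶜ
    rwa [res_res] at this
  let l1' : ℕ → MvPolynomial V k := fun j => if j < bH - bHw then l1 j else 0
  have hl1' : ∀ j, Rad (res G Uᶜ) (l1' j) := by
    intro j; simp only [l1']; split_ifs
    · exact hl1 j
    · exact rad_zero _
  refine Slot.mk' (S1 ∪ S2 ∪ (Finset.range (bT - bTz)).image (fun j => l1' j + l2 j))
    ({MvPolynomial.X w * MvPolynomial.X z} ∪ (Finset.Ico (bT - bTz) (bH - bHw)).image l1)
    ?_ ?_ ?_ ?_ ?_ ?_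
  · intro q hq
    rcases Finset.mem_union.1 hq with hq | hq
    · rcases Finset.mem_union.1 hq with hq | hq
      · exact (hr1 q hq).mono (res_le _ _)
      · exact (hr2 q hq).mono (res_le _ _)
    · obtain ⟨j, -, rfl⟩ := Finset.mem_image.1 hq
      exact ((hl1' j).mono (res_le _ _)).add ((hl2 j).mono (res_le _ _))
  · intro q hq
    rcases Finset.mem_union.1 hq with hq | hq
    · rw [Finset.mem_singleton.1 hq]; exact rad_edge hwz
    · obtain ⟨j, -, rfl⟩ := Finset.mem_image.1 hq
      exact (hl1 j).mono (res_le _ _)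
  · have a1 := Finset.card_union_le (S1 ∪ S2)
      ((Finset.range (bT - bTz)).image (fun j => l1' j + l2 j))
    have a2 := Finset.card_union_le S1 S2
    have a3 := Finset.card_image_le (s := Finset.range (bT - bTz)) (f := fun j => l1' j + l2 j)
    rw [Finset.card_range] at a3
    omega
  · have a1 := Finset.card_union_le (S1 ∪ S2)
      ((Finset.range (bT - bTz)).image (fun j => l1' j + l2 j))
    have a2 := Finset.card_union_le S1 S2
    have a3 := Finset.card_image_le (s := Finset.range (bT - bTz)) (f := fun j => l1' j + l2 j)
    rw [Finset.card_range] at a3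
    have a4 := Finset.card_union_le {MvPolynomial.X w * MvPolynomial.X z}
      ((Finset.Ico (bT - bTz) (bH - bHw)).image l1)
    have a5 := Finset.card_image_le (s := Finset.Ico (bT - bTz) (bH - bHw)) (f := l1)
    rw [Nat.card_Ico] at a5
    rw [Finset.card_singleton] at a4
    by_cases hh : bT - bTz < bH - bHw
    · have := hbig (by omega)
      omega
    · omega
  · intro P hP hS hXw
    have g1 : ∀ q ∈ S1, q ∈ P := fun q h => hS q (Finset.mem_union_left _ (Finset.mem_union_left _ h))
    have g2 : ∀ q ∈ S2, q ∈ P := fun q h => hS q (Finset.mem_union_left _ (Finset.mem_union_right _ h))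
    have g3 : ∀ j < bT - bTz, l1' j + l2 j ∈ P := fun j hj => hS _ (Finset.mem_union_right _
      (Finset.mem_image_of_mem (fun j => l1' j + l2 j) (Finset.mem_range.2 hj)))
    have hGH := hp1 P hP g1 (Or.inl hXw)
    have hGT := hp2 P hP g2 (Or.inr fun j hj =>
      (P.add_mem_iff_right (hl1' j P hP hGH)).1 (g3 j hj))
    intro u v huv
    by_cases hu : u ∈ U <;> by_cases hv : v ∈ U
    · exact hGT u v ⟨huv, hu, hv⟩
    · obtain ⟨rfl, rfl⟩ := hE u v huv hu hv
      exact P.mul_mem_left _ hXw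
    · obtain ⟨rfl, rfl⟩ := hE v u huv.symm hv hu
      exact P.mul_mem_right _ hXw
    · exact hGH u v ⟨huv, hu, hv⟩
  · intro P hP hS hL
    have g1 : ∀ q ∈ S1, q ∈ P := fun q h => hS q (Finset.mem_union_left _ (Finset.mem_union_left _ h))
    have g2 : ∀ q ∈ S2, q ∈ P := fun q h => hS q (Finset.mem_union_left _ (Finset.mem_union_right _ h))
    have g3 : ∀ j < bT - bTz, l1' j + l2 j ∈ P := fun j hj => hS _ (Finset.mem_union_right _
      (Finset.mem_image_of_mem (fun j => l1' j + l2 j) (Finset.mem_range.2 hj)))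
    have hedge : (MvPolynomial.X w * MvPolynomial.X z : MvPolynomial V k) ∈ P :=
      hL _ (Finset.mem_union_left _ (Finset.mem_singleton_self _))
    have hboth : GIn (res G Uᶜ) P ∧ GIn (res G U) P := by
      rcases hP.mem_or_mem hedge with hXw | hXz
      · have hGH := hp1 P hP g1 (Or.inl hXw)
        exact ⟨hGH, hp2 P hP g2 (Or.inr fun j hj =>
          (P.add_mem_iff_right (hl1' j P hP hGH)).1 (g3 j hj))⟩
      · have hGT := hp2 P hP g2 (Or.inl hXz)
        refine ⟨hp1 P hP g1 (Or.inr fun j hj => ?_), hGT⟩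
        by_cases hj2 : j < bT - bTz
        · have := (P.add_mem_iff_left (hl2 j P hP hGT)).1 (g3 j hj2)
          simpa only [l1', hj, if_true] using this
        · exact hL _ (Finset.mem_union_right _ (Finset.mem_image_of_mem _
            (Finset.mem_Ico.2 ⟨by omega, hj⟩)))
    obtain ⟨hGH, hGT⟩ := hboth
    intro u v huv
    by_cases hu : u ∈ U <;> by_cases hv : v ∈ U
    · exact hGT u v ⟨huv, hu, hv⟩
    · obtain ⟨rfl, rfl⟩ := hE u v huv hu hv
      rw [mul_comm]; exact hedge
    · obtain ⟨rfl, rfl⟩ := hE v u huv.symm hv hu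
      exact hedge
    · exact hGH u v ⟨huv, hu, hv⟩

theorem slot_Z {G : SimpleGraph V} {w w' : V} (hK : Slot k (res G {w}ᶜ) w')
    (h : bight (res G {w}ᶜ) ≤ bight (res G ({w} ∪ {z | G.Adj w z})ᶜ)) : Slot k G w := by
  classical
  obtain ⟨Q, hQ1, hQ2, hQ3⟩ := hK.total
  have hnc := nc_mono (res_le G {w}ᶜ)
  set N := (Set.toFinite {z | G.Adj w z}).toFinset with hN
  have hmemN : ∀ z, z ∈ N ↔ G.Adj w z := by intro z; simp [hN]
  have hcard : {z | G.Adj w z}.ncard = N.card := by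
    rw [hN, Set.ncard_eq_toFinset_card]
  refine Slot.mk' Q (N.image fun z => MvPolynomial.X w * MvPolynomial.X z) ?_ ?_ ?_ ?_ ?_ ?_
  · exact fun q hq => (hQ1 q hq).mono (res_le _ _)
  · intro q hq
    obtain ⟨z, hz, rfl⟩ := Finset.mem_image.1 hq
    exact rad_edge ((hmemN z).1 hz)
  · omega
  · have a1 := Finset.card_image_le (s := N)
      (f := fun z => (MvPolynomial.X w * MvPolynomial.X z : MvPolynomial V k))
    obtain ⟨J, hJU, hJ, hJc, -⟩ := exists_opt_res G ({w} ∪ {z | G.Adj w z})ᶜ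
    have h3 : ({z | G.Adj w z} ∪ nb (res G ({w} ∪ {z | G.Adj w z})ᶜ) J).ncard ≤ bight G := by
      refine bight_ge (I := {w} ∪ J) ?_ ?_
      · rintro u (rfl | hu) v (rfl | hv) huv
        · exact huv.ne rfl
        · exact hJU hv (Or.inr huv)
        · exact hJU hu (Or.inr huv.symm)
        · exact hJ u hu v hv huv
      · rintro v (hv | ⟨u, hu, huv⟩)
        · exact ⟨w, Or.inl rfl, hv⟩
        · exact ⟨u, Or.inr hu, huv.1⟩
    rw [Set.ncard_union_eq, hJc, hcard] at h3
    · omega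
    · rw [Set.disjoint_left]
      intro x hx hx'
      exact nb_res_sub _ _ _ hx' (Or.inr hx)
  · intro P hP hS hXw u v huv
    by_cases hu : u = w
    · subst hu; exact P.mul_mem_right _ hXw
    · by_cases hv : v = w
      · subst hv; exact P.mul_mem_left _ hXw
      · exact hQ3 P hP hS u v ⟨huv, hu, hv⟩
  · intro P hP hS hL u v huv
    have hL' : ∀ z, G.Adj w z → (MvPolynomial.X w * MvPolynomial.X z : MvPolynomial V k) ∈ P :=
      fun z hz => hL _ (Finset.mem_image_of_mem
        (fun z => (MvPolynomial.X w * MvPolynomial.X z : MvPolynomial V k)) ((hmemN z).2 hz))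
    by_cases hu : u = w
    · subst hu; exact hL' v huv
    · by_cases hv : v = w
      · subst hv; rw [mul_comm]; exact hL' u huv.symm
      · exact hQ3 P hP hS u v ⟨huv, hu, hv⟩

/-- If all branches at `w` are insensitive, the hypothesis of `slot_Z` holds. -/
theorem Z_hyp {G : SimpleGraph V} {w : V} (U : V → Set V)
    (hz : ∀ z, G.Adj w z → z ∈ U z) (hw : ∀ z, G.Adj w z → w ∉ U z)
    (hE : ∀ z, G.Adj w z → ∀ u v, G.Adj u v → u ∈ U z → v ∉ U z → u = z ∧ v = w)
    (hs : ∀ z, G.Adj w z → bight (res G (U z)) ≤ bight (res G (U z ∩ {z}ᶜ))) :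
    bight (res G {w}ᶜ) ≤ bight (res G ({w} ∪ {z | G.Adj w z})ᶜ) := by
  classical
  have key : ∀ J : Finset V, (∀ z ∈ J, G.Adj w z) →
      bight (res G {w}ᶜ) ≤ bight (res G ({w} ∪ (J : Set V))ᶜ) := by
    intro J
    induction J using Finset.induction_on with
    | empty => intro _; simp
    | insert z J hzJ ih =>
      intro hJ
      have ih' := ih fun x hx => hJ x (Finset.mem_insert_of_mem hx)
      have hwz := hJ z (Finset.mem_insert_self _ _)
      refine ih'.trans ?_
      have hcl : ∀ A : Set V, w ∉ A → ∀ u v, (res G A).Adj u v → u ∈ U z → v ∈ U z := by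
        intro A hA u v huv hu
        by_contra hv
        obtain ⟨-, rfl⟩ := hE z hwz u v huv.1 hu hv
        exact hA huv.2.2
      have hJU : ∀ x ∈ J, x ∉ U z := by
        intro x hx hxU
        have := (hE z hwz x w (hJ x (Finset.mem_insert_of_mem hx)).symm hxU (hw z hwz)).1
        subst this; exact hzJ hx
      rw [bight_split (res G ({w} ∪ (J : Set V))ᶜ) (U z) (hcl _ (by simp)),
        bight_split (res G ({w} ∪ ((insert z J : Finset V) : Set V))ᶜ) (U z) (hcl _ (by simp)),
        res_res, res_res, res_res, res_res]
      have e1 : ({w} ∪ (J : Set V))ᶜ ∩ U z = U z := by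
        ext x
        constructor
        · exact fun h => h.2
        · intro h
          refine ⟨?_, h⟩
          rintro (rfl | hx)
          · exact hw z hwz h
          · exact hJU x hx h
      have e2 : ({w} ∪ ((insert z J : Finset V) : Set V))ᶜ ∩ U z = U z ∩ {z}ᶜ := by
        ext x
        constructor
        · rintro ⟨h1, h2⟩
          exact ⟨h2, fun hx => h1 (Or.inr (Finset.mem_coe.2 (by rw [(hx : x = z)]; exact Finset.mem_insert_self _ _)))⟩
        · rintro ⟨h, hx⟩
          refine ⟨?_, h⟩
          rintro (rfl | hx')
          · exact hw z hwz h
          · rcases Finset.mem_insert.1 hx' with rfl | hx'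
            · exact hx rfl
            · exact hJU x hx' h
      have e3 : ({w} ∪ ((insert z J : Finset V) : Set V))ᶜ ∩ (U z)ᶜ =
          ({w} ∪ (J : Set V))ᶜ ∩ (U z)ᶜ := by
        ext x
        constructor
        · rintro ⟨h1, h2⟩
          refine ⟨?_, h2⟩
          rintro (rfl | hx)
          · exact h1 (Or.inl rfl)
          · exact h1 (Or.inr (Finset.mem_insert_of_mem hx))
        · rintro ⟨h1, h2⟩
          refine ⟨?_, h2⟩
          rintro (rfl | hx)
          · exact h1 (Or.inl rfl)
          · rcases Finset.mem_insert.1 hx with rfl | hx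
            · exact h2 (hz _ hwz)
            · exact h1 (Or.inr hx)
      rw [e1, e2, e3]
      have := hs z hwz
      omega
  have h1 := key (Set.toFinite {z | G.Adj w z}).toFinset (by intro z hz; simpa using hz)
  simpa using h1

theorem slot_of_del {G : SimpleGraph V} {w a b : V} (hab : G.Adj a b)
    (h : Slot k (G.deleteEdges {s(a, b)}) w) (hn : nc (G.deleteEdges {s(a, b)}) + 1 ≤ nc G)
    (h1 : bight (G.deleteEdges {s(a, b)}) ≤ bight G)
    (h2 : bight (res (G.deleteEdges {s(a, b)}) {w}ᶜ) ≤ bight (res G {w}ᶜ)) : Slot k G w := by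
  classical
  obtain ⟨S, L, hS, hL, c1, c2, p1, p2⟩ := h.fin
  have hle : G.deleteEdges {s(a, b)} ≤ G := deleteEdges_le _
  have hext : ∀ P : Ideal (MvPolynomial V k), MvPolynomial.X a * MvPolynomial.X b ∈ P →
      GIn (G.deleteEdges {s(a, b)}) P → GIn G P := by
    intro P hP hG u v huv
    by_cases he : s(u, v) = s(a, b)
    · rcases Sym2.eq_iff.1 he with ⟨rfl, rfl⟩ | ⟨rfl, rfl⟩
      · exact hP
      · rw [mul_comm]; exact hP
    · exact hG u v (SimpleGraph.deleteEdges_adj.2 ⟨huv, he⟩)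
  have hc := Finset.card_insert_le (MvPolynomial.X a * MvPolynomial.X b) S
  refine Slot.mk' (insert (MvPolynomial.X a * MvPolynomial.X b) S) L ?_ ?_ ?_ ?_ ?_ ?_
  · intro q hq
    rcases Finset.mem_insert.1 hq with rfl | hq
    · exact rad_edge hab
    · exact (hS q hq).mono hle
  · exact fun q hq => (hL q hq).mono hle
  · omega
  · omega
  · intro P hP hq hw
    exact hext P (hq _ (Finset.mem_insert_self _ _))
      (p1 P hP (fun q h => hq q (Finset.mem_insert_of_mem h)) hw)
  · intro P hP hq hw
    exact hext P (hq _ (Finset.mem_insert_self _ _))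
      (p2 P hP (fun q h => hq q (Finset.mem_insert_of_mem h)) hw)

/-- If deleting `w` does not change the big height, any total family will do. -/
theorem slot_of_eq {G : SimpleGraph V} {w w' : V} (h : Slot k G w')
    (hb : bight G ≤ bight (res G {w}ᶜ)) : Slot k G w := by
  obtain ⟨Q, h1, h2, h3⟩ := h.total
  refine Slot.mk' Q ∅ h1 (by simp) (by omega) (by simpa using h2) ?_ ?_
  · exact fun P hP hQ _ => h3 P hP hQ
  · exact fun P hP hQ _ => h3 P hP hQ

theorem slot_of_no_edges {G : SimpleGraph V} {w : V} (h : ∀ u v, ¬ G.Adj u v) : Slot k G w := by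
  refine Slot.mk' ∅ ∅ (by simp) (by simp) (by simp) (by simp) ?_ ?_
  · exact fun P _ _ _ u v huv => absurd huv (h u v)
  · exact fun P _ _ _ u v huv => absurd huv (h u v)

theorem leaf_gain {G : SimpleGraph V} {u w : V} (hu : ∀ v, G.Adj u v ↔ v = w) :
    bight (res G {w}ᶜ) + 1 ≤ bight G := by
  obtain ⟨J, hJU, hJ, hJc, -⟩ := exists_opt_res G {w}ᶜ
  have h3 : (nb (res G {w}ᶜ) J ∪ {w}).ncard ≤ bight G := by
    refine bight_ge (I := J ∪ {u}) ?_ ?_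
    · rintro x (hx | rfl) v (hv | rfl) huv
      · exact hJ x hx v hv huv
      · exact hJU hx ((hu x).1 huv.symm)
      · exact hJU hv ((hu v).1 huv)
      · exact huv.ne rfl
    · rintro v (⟨u, hu, huv⟩ | rfl)
      · exact ⟨u, Or.inl hu, huv.1⟩
      · exact ⟨u, Or.inr rfl, (hu v).2 rfl⟩
  rw [Set.ncard_union_eq, Set.ncard_singleton, hJc] at h3
  · exact h3
  · rw [Set.disjoint_singleton_right]
    exact fun h => nb_res_sub _ _ _ h rfl

end steps

section slots

variable [Finite V] {k : Type} [Field k]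

theorem res_split {D : SimpleGraph V} {U : Set V} (hU : ∀ u v, D.Adj u v → u ∈ U → v ∈ U)
    (A : Set V) : bight (res D A) = bight (res D (A ∩ U)) + bight (res D (A ∩ Uᶜ)) := by
  rw [bight_split (res D A) U (fun u v h hu => hU u v h.1 hu), res_res, res_res]

/-- Deleting several vertices in distinct components. -/
theorem sig_add {D : SimpleGraph V} (X : Finset V) (a : V) (haX : ∀ x ∈ X, ¬ D.Reachable a x) :
    bight (res D (X : Set V)ᶜ) + bight (res D {a}ᶜ) =
      bight D + bight (res D (insert a (X : Set V))ᶜ) := by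
  have hU := reach_closed D a
  set U := {x | D.Reachable a x} with hUdef
  have haU : a ∈ U := Reachable.refl _
  have h1 := res_split hU (X : Set V)ᶜ
  have h2 := res_split hU {a}ᶜ
  have h3 := bight_split D U hU
  have h4 := res_split hU (insert a (X : Set V))ᶜ
  have e1 : (X : Set V)ᶜ ∩ U = U := by
    ext x; exact ⟨fun h => h.2, fun h => ⟨fun hx => haX x hx h, h⟩⟩
  have e2 : ({a}ᶜ : Set V) ∩ Uᶜ = Uᶜ := by
    ext x
    refine ⟨fun h => h.2, fun h => ⟨?_, h⟩⟩
    rintro rfl; exact h haU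
  have e3 : (insert a (X : Set V))ᶜ ∩ U = {a}ᶜ ∩ U := by
    ext x
    constructor
    · rintro ⟨h, h'⟩; exact ⟨fun hx => h (Or.inl hx), h'⟩
    · rintro ⟨h, h'⟩
      refine ⟨?_, h'⟩
      rintro (hx | hx)
      · exact h hx
      · exact haX x hx h'
  have e4 : (insert a (X : Set V))ᶜ ∩ Uᶜ = (X : Set V)ᶜ ∩ Uᶜ := by
    ext x
    constructor
    · rintro ⟨h, h'⟩; exact ⟨fun hx => h (Or.inr hx), h'⟩
    · rintro ⟨h, h'⟩
      refine ⟨?_, h'⟩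
      rintro (rfl | hx)
      · exact h' haU
      · exact h hx
  rw [e1] at h1
  rw [e2] at h2
  rw [e3, e4] at h4
  omega

theorem wsum {D : SimpleGraph V} (X : Finset V)
    (hX : ∀ a ∈ X, ∀ b ∈ X, a ≠ b → ¬ D.Reachable a b) :
    bight (res D (X : Set V)ᶜ) + ∑ a ∈ X, (bight D - bight (res D {a}ᶜ)) = bight D := by
  classical
  induction X using Finset.induction_on with
  | empty => simp [res_univ]
  | insert a X ha ih =>
    have ih' := ih fun x hx y hy =>
      hX x (Finset.mem_insert_of_mem hx) y (Finset.mem_insert_of_mem hy)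
    have h1 := sig_add (D := D) X a fun x hx =>
      hX a (Finset.mem_insert_self _ _) x (Finset.mem_insert_of_mem hx) (by rintro rfl; exact ha hx)
    rw [Finset.sum_insert ha, Finset.coe_insert]
    have := bight_res_le D {a}ᶜ
    omega

theorem SL (w : V) (J : Finset V) : ∀ D : SimpleGraph V, (∀ H ≤ D, ∀ b, Slot k H b) →
    (∀ a ∈ J, ∀ b ∈ J, a ≠ b → ¬ D.Reachable a b) →
    ∃ (B : Finset (MvPolynomial V k)) (l : V → ℕ → MvPolynomial V k),
      (∀ q ∈ B, Rad D q) ∧ (∀ a j, Rad D (l a j)) ∧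
      B.card ≤ bight (res D (J : Set V)ᶜ) + nc D ∧
      (∀ P : Ideal (MvPolynomial V k), P.IsPrime → (∀ q ∈ B, q ∈ P) →
        ∀ a ∈ J, MvPolynomial.X a ∈ P → ∀ j, l a j ∈ P) ∧
      (∀ P : Ideal (MvPolynomial V k), P.IsPrime → (∀ q ∈ B, q ∈ P) →
        (∀ a ∈ J, MvPolynomial.X a ∈ P ∨ ∀ j < bight D - bight (res D {a}ᶜ), l a j ∈ P) →
        GIn D P) := by
  classical
  induction J using Finset.induction_on with
  | empty =>
    intro D hD _
    obtain ⟨Q, h1, h2, h3⟩ := (hD D le_rfl w).total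
    refine ⟨Q, fun _ _ => 0, h1, fun _ _ => rad_zero _, ?_, by simp, fun P hP hQ _ => h3 P hP hQ⟩
    simpa [res_univ] using h2
  | insert a J ha ih =>
    intro D hD hJ
    have hU := reach_closed D a
    have haX : ∀ x ∈ J, ¬ D.Reachable a x := fun x hx =>
      hJ a (Finset.mem_insert_self _ _) x (Finset.mem_insert_of_mem hx) (by rintro rfl; exact ha hx)
    set U := {x | D.Reachable a x} with hUdef
    have haU : a ∈ U := Reachable.refl _
    obtain ⟨S, l0, s1, s2, s3, s4⟩ := hD (res D U) (res_le _ _) a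
    obtain ⟨B, l, b1, b2, b3, b4, b5⟩ := ih (res D Uᶜ)
      (fun H hH b => hD H (hH.trans (res_le _ _)) b)
      (fun x hx y hy hxy hr => hJ x (Finset.mem_insert_of_mem hx) y (Finset.mem_insert_of_mem hy)
        hxy (hr.mono (res_le _ _)))
    have hnc : nc (res D Uᶜ) + nc (res D U) ≤ nc D :=
      nc_add (res_le _ _) (res_le _ _) (fun u v h h' => h.2.1 h'.2.1)
    rw [res_res] at s3 s4 b3
    have h3 := bight_split D U hU
    have h2 := res_split hU {a}ᶜ
    have h4 := res_split hU (insert a (J : Set V))ᶜ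
    have e2 : ({a}ᶜ : Set V) ∩ Uᶜ = Uᶜ := by
      ext x
      refine ⟨fun h => h.2, fun h => ⟨?_, h⟩⟩
      rintro rfl; exact h haU
    have e3 : (insert a (J : Set V))ᶜ ∩ U = U ∩ {a}ᶜ := by
      ext x
      constructor
      · rintro ⟨h, h'⟩; exact ⟨h', fun hx => h (Or.inl hx)⟩
      · rintro ⟨h', h⟩
        refine ⟨?_, h'⟩
        rintro (hx | hx)
        · exact h hx
        · exact haX x hx h'
    have e4 : (insert a (J : Set V))ᶜ ∩ Uᶜ = Uᶜ ∩ (J : Set V)ᶜ := by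
      ext x
      constructor
      · rintro ⟨h, h'⟩; exact ⟨h', fun hx => h (Or.inr hx)⟩
      · rintro ⟨h', h⟩
        refine ⟨?_, h'⟩
        rintro (rfl | hx)
        · exact h' haU
        · exact h hx
    rw [e3, e4] at h4
    rw [e2, Set.inter_comm] at h2
    refine ⟨S ∪ B, Function.update l a l0, ?_, ?_, ?_, ?_, ?_⟩
    · intro q hq
      rcases Finset.mem_union.1 hq with h | h
      · exact (s1 q h).mono (res_le _ _)
      · exact (b1 q h).mono (res_le _ _)
    · intro b j
      by_cases hb : b = a
      · subst hb; rw [Function.update_self]; exact (s2 j).mono (res_le _ _)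
      · rw [Function.update_of_ne hb]; exact (b2 b j).mono (res_le _ _)
    · have := Finset.card_union_le S B
      rw [Finset.coe_insert]
      omega
    · intro P hP hq b hb hXb j
      by_cases hba : b = a
      · subst hba; rw [Function.update_self]
        exact s2 j P hP (s4 P hP (fun q h => hq q (Finset.mem_union_left _ h)) (Or.inl hXb))
      · rw [Function.update_of_ne hba]
        exact b4 P hP (fun q h => hq q (Finset.mem_union_right _ h)) b
          ((Finset.mem_insert.1 hb).resolve_left hba) hXb j
    · intro P hP hq hall
      have hT : GIn (res D U) P := by
        refine s4 P hP (fun q h => hq q (Finset.mem_union_left _ h)) ?_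
        rcases hall a (Finset.mem_insert_self _ _) with h | h
        · exact Or.inl h
        · refine Or.inr fun j hj => ?_
          have := h j (by omega)
          rwa [Function.update_self] at this
      have hD' : GIn (res D Uᶜ) P := by
        refine b5 P hP (fun q h => hq q (Finset.mem_union_right _ h)) fun b hb => ?_
        have hbU := haX b hb
        have hba : b ≠ a := by rintro rfl; exact ha hb
        rcases hall b (Finset.mem_insert_of_mem hb) with h | h
        · exact Or.inl h
        · refine Or.inr fun j hj => ?_
          have h5 := res_split hU {b}ᶜ
          have e5 : ({b}ᶜ : Set V) ∩ U = U := by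
            ext x
            refine ⟨fun hh => hh.2, fun hx => ⟨?_, hx⟩⟩
            rintro rfl; exact hbU hx
          rw [e5, Set.inter_comm] at h5
          rw [res_res] at hj
          have := h j (by omega)
          rwa [Function.update_of_ne hba] at this
      intro u v huv
      by_cases hu : u ∈ U
      · exact hT u v ⟨huv, hu, hU u v huv hu⟩
      · exact hD' u v ⟨huv, hu, fun hv => hu (hU v u huv.symm hv)⟩

end slots

section breaks

variable [Finite V] {k : Type} [Field k] {G D : SimpleGraph V} {m : ℕ} {v : ℕ → V}

theorem CycData.leave (h : CycData G D m v) {i : ℕ} (h1 : 1 ≤ i) (hi : i < m) :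
    ∀ x y, G.Adj x y → x ∈ {x | D.Reachable (v i) x} → y ∉ {x | D.Reachable (v i) x} →
      x = v i ∧ (y = v (i + 1) ∨ y = v (i - 1)) := by
  intro x y hxy hx hy
  rcases h.edge x y hxy with hD | ⟨j, hj, he⟩
  · exact absurd (reach_closed D (v i) x y hD hx) hy
  · have key : ∀ j < m, v j = x → j = i := by
      intro j hj hjx
      by_contra hne
      exact h.sep i hi j hj (Ne.symm hne) (by rw [hjx]; exact hx)
    rcases Sym2.eq_iff.1 he with ⟨e1, e2⟩ | ⟨e1, e2⟩
    · have := key j hj e1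
      subst this
      exact ⟨e1.symm, Or.inl e2.symm⟩
    · by_cases hjm : j + 1 < m
      · have := key (j + 1) hjm e2
        subst this
        exact ⟨e2.symm, Or.inr e1.symm⟩
      · have hjm' : j + 1 = m := by omega
        rw [hjm', h.h0] at e2
        have := key 0 (by omega) e2
        omega

theorem CycData.resU (h : CycData G D m v) {i : ℕ} (hi : i < m) {A : Set V}
    (hA : A ⊆ {x | D.Reachable (v i) x}) : res G A = res D A := by
  ext x y
  constructor
  · rintro ⟨hxy, hx, hy⟩
    refine ⟨?_, hx, hy⟩
    rcases h.edge x y hxy with hD | ⟨j, hj, he⟩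
    · exact hD
    · exfalso
      have hr : D.Reachable (v j) (v (j + 1)) := by
        rcases Sym2.eq_iff.1 he with ⟨e1, e2⟩ | ⟨e1, e2⟩
        · rw [e1, e2]; exact (hA hx).symm.trans (hA hy)
        · rw [e1, e2]; exact (hA hy).symm.trans (hA hx)
      by_cases hjm : j + 1 < m
      · exact h.sep j hj (j + 1) hjm (by omega) hr
      · have hjm' : j + 1 = m := by omega
        rw [hjm', h.h0] at hr
        have := h.hm
        exact h.sep j hj 0 (by omega) (by omega) hr
  · rintro ⟨hxy, hx, hy⟩
    exact ⟨h.le hxy, hx, hy⟩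

theorem CycData.succ_notMem (h : CycData G D m v) {i j : ℕ} (hi : i < m) (hj : j < m) (h1 : 1 ≤ j)
    (hij : i + 1 ≠ j) : v (i + 1) ∉ {x | D.Reachable (v j) x} := by
  intro hr
  by_cases him : i + 1 < m
  · exact h.sep j hj (i + 1) him (Ne.symm hij) hr
  · have him' : i + 1 = m := by omega
    rw [him', h.h0] at hr
    exact h.sep j hj 0 (by omega) (by omega) hr

theorem res_deleteEdges (G : SimpleGraph V) (A : Set V) (s : Set (Sym2 V)) :
    res (G.deleteEdges s) A = (res G A).deleteEdges s := by
  ext x y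
  simp only [res_adj, SimpleGraph.deleteEdges_adj]
  tauto

theorem CycData.br_i (h : CycData G D m v) {i : ℕ} (h1 : 1 ≤ i) (hi : i < m) (A : Set V)
    (hA : {x | D.Reachable (v i) x} ⊆ A) (hb : v (i + 1) ∈ A)
    (hs : bight (res D {x | D.Reachable (v i) x}) ≤
      bight (res D ({x | D.Reachable (v i) x} ∩ {v i}ᶜ))) :
    bight (res (G.deleteEdges {s(v i, v (i + 1))}) A) ≤ bight (res G A) := by
  rw [res_deleteEdges]
  have hiU : v i ∈ {x | D.Reachable (v i) x} := Reachable.refl _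
  refine break_i (U := {x | D.Reachable (v i) x}) (c := v (i - 1)) hiU
    (h.succ_notMem hi hi h1 (by omega)) ⟨h.adj i hi, hA hiU, hb⟩ ?_ ?_
  · exact fun x y hxy => h.leave h1 hi x y hxy.1
  · rw [res_res, res_res, Set.inter_eq_right.2 hA,
      Set.inter_eq_right.2 (Set.sdiff_subset.trans hA), h.resU hi subset_rfl,
      h.resU hi Set.sdiff_subset]
    exact hs

theorem CycData.br_ii (h : CycData G D m v) {i j : ℕ} (h1 : 1 ≤ i) (hi : i < m)
    (h1j : 1 ≤ j) (hj : j < m) (hij : i ≠ j) {b : V} (A : Set V)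
    (hA : {x | D.Reachable (v i) x} ⊆ A) (hAj : {x | D.Reachable (v j) x} ⊆ A) (hb : b ∈ A)
    (hbi : b ∉ {x | D.Reachable (v i) x}) (hbj : b ∉ {x | D.Reachable (v j) x})
    (hadj : G.Adj (v i) b)
    (hleave : ∀ y, y = v (i + 1) ∨ y = v (i - 1) → y = b ∨ y = v j)
    (hs : bight (res D {x | D.Reachable (v i) x}) ≤
      bight (res D ({x | D.Reachable (v i) x} ∩ {v i}ᶜ)) + 1)
    (hsj : bight (res D ({x | D.Reachable (v j) x} ∩ {v j}ᶜ)) + 1 ≤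
      bight (res D {x | D.Reachable (v j) x})) :
    bight (res (G.deleteEdges {s(v i, b)}) A) ≤ bight (res G A) := by
  rw [res_deleteEdges]
  have hiU : v i ∈ {x | D.Reachable (v i) x} := Reachable.refl _
  refine break_ii (U := {x | D.Reachable (v i) x}) (W := {x | D.Reachable (v j) x}) (c := v j) hiU
    hbi ⟨hadj, hA hiU, hb⟩ ?_ ?_ (Reachable.refl _) hbj ?_ ?_ ?_
  · intro x y hxy hx hy
    obtain ⟨e1, e2⟩ := h.leave h1 hi x y hxy.1 hx hy
    exact ⟨e1, hleave y e2⟩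
  · rw [res_res, res_res, Set.inter_eq_right.2 hA,
      Set.inter_eq_right.2 (Set.sdiff_subset.trans hA), h.resU hi subset_rfl,
      h.resU hi Set.sdiff_subset]
    exact hs
  · rw [Set.disjoint_left]
    intro x hx hx'
    exact h.sep i hi j hj hij (Reachable.trans hx (Reachable.symm hx'))
  · intro x y hxy hx hy
    exact (h.leave h1j hj x y hxy.1 hx hy).1
  · rw [res_res, res_res, Set.inter_eq_right.2 hAj,
      Set.inter_eq_right.2 (Set.sdiff_subset.trans hAj), h.resU hj subset_rfl,
      h.resU hj Set.sdiff_subset]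
    exact hsj

/-- Local and global versions of the drop at `v i` agree. -/
theorem sig_local (D : SimpleGraph V) (a : V) :
    bight (res D {x | D.Reachable a x}) + bight (res D {a}ᶜ) =
      bight D + bight (res D ({x | D.Reachable a x} ∩ {a}ᶜ)) := by
  have hU := reach_closed D a
  have h2 := res_split hU {a}ᶜ
  have h3 := bight_split D _ hU
  have e2 : ({a}ᶜ : Set V) ∩ {x | D.Reachable a x}ᶜ = {x | D.Reachable a x}ᶜ := by
    ext x
    refine ⟨fun h => h.2, fun h => ⟨?_, h⟩⟩
    rintro rfl; exact h (Reachable.refl _)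
  rw [e2, Set.inter_comm] at h2
  omega

theorem slot_break (h : CycData G D m v) {i : ℕ} (h1 : 1 ≤ i) (hi : i < m)
    (IH : ∀ j < m, Slot k (G.deleteEdges {s(v j, v (j + 1))}) (v 0))
    (hs : bight D ≤ bight (res D {v i}ᶜ) ∨ (bight D ≤ bight (res D {v i}ᶜ) + 1 ∧
      ∀ j, 1 ≤ j → j < m → bight (res D {v j}ᶜ) + 1 ≤ bight D)) : Slot k G (v 0) := by
  have hm := h.hm
  have hUA : ∀ j, 1 ≤ j → j < m → {x | D.Reachable (v j) x} ⊆ {v 0}ᶜ := by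
    intro j h1 hj x hx hx0
    rw [Set.mem_singleton_iff] at hx0
    subst hx0
    exact h.sep j hj 0 (by omega) (by omega) hx
  have hdel0 : ∀ b, bight (res (G.deleteEdges {s(b, v 0)}) {v 0}ᶜ) ≤ bight (res G {v 0}ᶜ) := by
    intro b
    apply le_of_eq
    congr 1
    ext x y
    rw [res_deleteEdges, SimpleGraph.deleteEdges_adj]
    constructor
    · exact fun h => h.1
    · intro h
      refine ⟨h, fun he => ?_⟩
      rcases Sym2.eq_iff.1 (Set.mem_singleton_iff.1 he) with ⟨e1, e2⟩ | ⟨e1, e2⟩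
      · exact h.2.2 e2
      · exact h.2.1 e1
  have hloc := sig_local D (v i)
  rcases hs with hs | ⟨hs, hall⟩
  · refine slot_of_del (h.adj i hi) (IH i hi) (h.nce i hi) ?_ ?_
    · have := h.br_i h1 hi Set.univ (Set.subset_univ _) trivial (by omega)
      simpa only [res_univ] using this
    · by_cases him : i + 1 < m
      · refine h.br_i h1 hi _ (hUA i h1 hi) ?_ (by omega)
        intro he
        have := h.inj (i + 1) him 0 (by omega) he
        omega
      · have : i + 1 = m := by omega
        rw [this, h.h0]
        exact hdel0 _
  · by_cases hi2 : 2 ≤ i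
    · have hj := hall (i - 1) (by omega) (by omega)
      have hlocj := sig_local D (v (i - 1))
      have gen := fun A hA hAj hb => h.br_ii (j := i - 1) (b := v (i + 1)) h1 hi (by omega)
        (by omega) (by omega) A hA hAj hb (h.succ_notMem hi hi h1 (by omega))
        (h.succ_notMem hi (by omega) (by omega) (by omega)) (h.adj i hi) (fun y hy => hy)
        (by omega) (by omega)
      refine slot_of_del (h.adj i hi) (IH i hi) (h.nce i hi) ?_ ?_
      · have := gen Set.univ (Set.subset_univ _) (Set.subset_univ _) trivial
        simpa only [res_univ] using this
      · by_cases him : i + 1 < m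
        · refine gen _ (hUA i h1 hi) (hUA _ (by omega) (by omega)) ?_
          intro he
          have := h.inj (i + 1) him 0 (by omega) he
          omega
        · have : i + 1 = m := by omega
          rw [this, h.h0]
          exact hdel0 _
    · have : i = 1 := by omega
      subst this
      have hj := hall 2 (by omega) (by omega)
      have hlocj := sig_local D (v 2)
      have hI := IH 0 (by omega)
      have hn := h.nce 0 (by omega)
      have hadj := (h.adj 0 (by omega)).symm
      rw [Sym2.eq_swap] at hI hn
      refine slot_of_del hadj hI hn ?_ (hdel0 _)
      have := h.br_ii (i := 1) (j := 2) (b := v 0) (by omega) hi (by omega) (by omega) (by omega)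
        Set.univ (Set.subset_univ _) (Set.subset_univ _) trivial
        (h.sep 1 (by omega) 0 (by omega) (by omega)) (h.sep 2 (by omega) 0 (by omega) (by omega))
        hadj (fun y hy => hy.symm) (by omega) (by omega)
      simpa only [res_univ] using this

end breaks

section special

variable [Finite V] {k : Type} [Field k] {G D : SimpleGraph V} {m : ℕ} {v : ℕ → V}

/-- Cyclic adjacency of indices. -/
def cadj (m i j : ℕ) : Prop := (i + 1) % m = j ∨ (j + 1) % m = i

theorem cadj.symm {m i j : ℕ} (h : cadj m i j) : cadj m j i := Or.symm h

theorem not_cadj_self {m i : ℕ} (hm : 3 ≤ m) (hi : i < m) : ¬ cadj m i i := by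
  intro h
  have h' : (i + 1) % m = i := by rcases h with h | h <;> exact h
  by_cases h1 : i + 1 < m
  · rw [Nat.mod_eq_of_lt h1] at h'; omega
  · have : i + 1 = m := by omega
    rw [this, Nat.mod_self] at h'; omega

theorem exists_maxIndep (m : ℕ) (hm : 3 ≤ m) (R : Finset ℕ) (hR : ∀ x ∈ R, x < m) (om : ℕ → ℕ) :
    ∃ Y ⊆ R, (∀ x ∈ Y, ∀ y ∈ Y, ¬ cadj m x y) ∧
      (∀ Y' ⊆ R, (∀ x ∈ Y', ∀ y ∈ Y', ¬ cadj m x y) → ∑ i ∈ Y', om i ≤ ∑ i ∈ Y, om i) ∧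
      (∀ x ∈ R, x ∉ Y → 1 ≤ om x → ∃ y ∈ Y, cadj m x y) := by
  classical
  obtain ⟨Y, hY, hmax⟩ := Finset.exists_max_image
    (R.powerset.filter fun Y => ∀ x ∈ Y, ∀ y ∈ Y, ¬ cadj m x y) (fun Y => ∑ i ∈ Y, om i)
    ⟨∅, by simp⟩
  simp only [Finset.mem_filter, Finset.mem_powerset] at hY hmax
  refine ⟨Y, hY.1, hY.2, fun Y' h1 h2 => hmax Y' ⟨h1, h2⟩, ?_⟩
  intro x hx hxY hom
  by_contra hno
  push Not at hno
  have h1 := hmax (insert x Y) ⟨Finset.insert_subset hx hY.1, ?_⟩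
  · rw [Finset.sum_insert hxY] at h1; omega
  · intro a ha b hb
    rcases Finset.mem_insert.1 ha with rfl | ha' <;> rcases Finset.mem_insert.1 hb with rfl | hb'
    · exact not_cadj_self hm (hR _ hx)
    · exact hno b hb'
    · exact fun h => hno a ha' h.symm
    · exact hY.2 a ha' b hb'

theorem CycData.vmod (h : CycData G D m v) {i : ℕ} (hi : i < m) : v ((i + 1) % m) = v (i + 1) := by
  by_cases h1 : i + 1 < m
  · rw [Nat.mod_eq_of_lt h1]
  · have : i + 1 = m := by omega
    rw [this, Nat.mod_self, h.h0]

theorem CycData.cadj_adj (h : CycData G D m v) {i j : ℕ} (hi : i < m) (hj : j < m)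
    (hc : cadj m i j) : G.Adj (v i) (v j) := by
  rcases hc with hc | hc
  · rw [← hc, h.vmod hi]; exact h.adj i hi
  · rw [← hc, h.vmod hj]; exact (h.adj j hj).symm

theorem CycData.ws (h : CycData G D m v) [DecidableEq V] (T : Finset ℕ) (hT : ∀ i ∈ T, i < m) :
    bight (res D ((T.image v : Finset V) : Set V)ᶜ) +
      ∑ i ∈ T, (bight D - bight (res D {v i}ᶜ)) = bight D := by
  have h1 := wsum (D := D) (T.image v) (by
    intro a ha b hb hab
    obtain ⟨i, hi, rfl⟩ := Finset.mem_image.1 ha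
    obtain ⟨j, hj, rfl⟩ := Finset.mem_image.1 hb
    exact h.sep i (hT i hi) j (hT j hj) (by rintro rfl; exact hab rfl))
  rw [Finset.sum_image] at h1
  · exact h1
  · intro a ha b hb hab
    exact h.inj a (hT a ha) b (hT b hb) hab

theorem CycData.LBc (h : CycData G D m v) [DecidableEq V] (O X Y : Finset ℕ)
    (hO : ∀ i ∈ O, i < m) (hX : ∀ i ∈ X, i < m) (hY : ∀ i ∈ Y, i < m)
    (hOX : Disjoint O X) (hYX : Disjoint Y X) (hYO : Disjoint Y O)
    (hpair : ∀ i < m, i ∈ O ∪ X ∨ (i + 1) % m ∈ O ∪ X)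
    (hdom : ∀ x ∈ X, ∃ y ∈ Y, cadj m x y)
    (hs : ∀ y ∈ Y, bight (res D {v y}ᶜ) + 2 ≤ bight D) :
    X.card + bight (res D (((O ∪ X).image v : Finset V) : Set V)ᶜ) ≤
      bight (res G ((O.image v : Finset V) : Set V)ᶜ) := by
  have hmemX : ∀ (T : Finset ℕ), (∀ i ∈ T, i < m) → ∀ i < m,
      (v i ∈ ((T.image v : Finset V) : Set V) ↔ i ∈ T) := by
    intro T hT i hi
    simp only [Finset.coe_image, Set.mem_image, Finset.mem_coe]
    constructor
    · rintro ⟨j, hj, he⟩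
      rwa [← h.inj j (hT j hj) i hi he]
    · exact fun hh => ⟨i, hh, rfl⟩
  have hun : (((O ∪ X).image v : Finset V) : Set V)ᶜ =
      ((O.image v : Finset V) : Set V)ᶜ ∩ ((X.image v : Finset V) : Set V)ᶜ := by
    rw [Finset.image_union, Finset.coe_union, Set.compl_union]
  have hcard : ((X.image v : Finset V) : Set V).ncard = X.card := by
    rw [Set.ncard_coe_finset, Finset.card_image_of_injOn]
    intro a ha b hb hab
    exact h.inj a (hX a ha) b (hX b hb) hab
  have key := LB (G := res G ((O.image v : Finset V) : Set V)ᶜ)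
    (D := res D ((O.image v : Finset V) : Set V)ᶜ) (res_mono h.le le_rfl)
    ((X.image v : Finset V) : Set V) ((Y.image v : Finset V) : Set V) ?_ ?_ ?_ ?_
  · rw [hcard, res_res, ← hun] at key
    exact key
  · intro y hy
    obtain ⟨i, hi, rfl⟩ := Finset.mem_image.1 (Finset.mem_coe.1 hy)
    rw [hmemX X hX i (hY i hi)]
    exact Finset.disjoint_left.1 hYX hi
  · rintro a b ⟨hab, ha, hb⟩
    rcases h.edge a b hab with hD | ⟨i, hi, he⟩
    · exact Or.inl ⟨hD, ha, hb⟩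
    · right
      have hi2 : (i + 1) % m < m := Nat.mod_lt _ (by omega)
      have e1 := hmemX X hX i hi
      have e2 := hmemX X hX _ hi2
      have e3 := hmemX O hO i hi
      have e4 := hmemX O hO _ hi2
      rw [h.vmod hi] at e2 e4
      have hp := hpair i hi
      rw [Finset.mem_union, Finset.mem_union, ← e1, ← e2, ← e3, ← e4] at hp
      rw [Set.mem_compl_iff] at ha hb
      rcases Sym2.eq_iff.1 he with ⟨rfl, rfl⟩ | ⟨rfl, rfl⟩ <;> tauto
  · intro x hx
    obtain ⟨i, hi, rfl⟩ := Finset.mem_image.1 (Finset.mem_coe.1 hx)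
    obtain ⟨j, hj, hc⟩ := hdom i hi
    refine ⟨v j, (hmemX Y hY j (hY j hj)).2 hj, h.cadj_adj (hX i hi) (hY j hj) hc, ?_, ?_⟩
    · rw [Set.mem_compl_iff, hmemX O hO i (hX i hi)]
      exact Finset.disjoint_right.1 hOX hi
    · rw [Set.mem_compl_iff, hmemX O hO j (hY j hj)]
      exact Finset.disjoint_left.1 hYO hj
  · intro y hy
    obtain ⟨j, hj, rfl⟩ := Finset.mem_image.1 (Finset.mem_coe.1 hy)
    have hOXm : ∀ i ∈ O ∪ X, i < m := fun i hi => (Finset.mem_union.1 hi).elim (hO i) (hX i)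
    have hjn : j ∉ O ∪ X := by
      rw [Finset.mem_union]
      rintro (h' | h')
      · exact Finset.disjoint_left.1 hYO hj h'
      · exact Finset.disjoint_left.1 hYX hj h'
    have w1 := h.ws (O ∪ X) hOXm
    have w2 := h.ws (insert j (O ∪ X)) (fun i hi => (Finset.mem_insert.1 hi).elim
      (fun e => e ▸ hY j hj) (hOXm i))
    rw [Finset.sum_insert hjn] at w2
    have hun2 : (((insert j (O ∪ X)).image v : Finset V) : Set V)ᶜ =
      ((O.image v : Finset V) : Set V)ᶜ ∩ (((X.image v : Finset V) : Set V) ∪ {v j})ᶜ := by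
      rw [Finset.image_insert, Finset.coe_insert, Finset.image_union, Finset.coe_union,
        ← Set.compl_union]
      congr 1
      ext x
      simp only [Set.mem_insert_iff, Set.mem_union, Set.mem_singleton_iff]
      tauto
    rw [res_res, res_res, ← hun, ← hun2]
    have := hs j hj
    omega

/-- The numerical estimates for the special cycle case. -/
theorem CycData.counts (h : CycData G D m v) [DecidableEq V]
    (hs : ∀ i, 1 ≤ i → i < m → bight (res D {v i}ᶜ) + 2 ≤ bight D) :
    ∃ W1 W : ℕ, W1 ≤ W ∧
      (∀ Y' ⊆ Finset.range m, (∀ x ∈ Y', ∀ y ∈ Y', ¬ cadj m x y) →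
        ∑ i ∈ Y', (bight D - bight (res D {v i}ᶜ) - 1) ≤ W) ∧
      (∀ Y' ⊆ Finset.Ico 1 m, (∀ x ∈ Y', ∀ y ∈ Y', ¬ cadj m x y) →
        ∑ i ∈ Y', (bight D - bight (res D {v i}ᶜ) - 1) ≤ W1) ∧
      bight (res D (((Finset.range m).image v : Finset V) : Set V)ᶜ) + m + W1 ≤
        bight (res G {v 0}ᶜ) + 1 ∧
      bight (res D (((Finset.range m).image v : Finset V) : Set V)ᶜ) + m + W +
        min 1 (bight D - bight (res D {v 0}ᶜ)) ≤ bight G + 1 := by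
  have hm := h.hm
  set σ : ℕ → ℕ := fun i => bight D - bight (res D {v i}ᶜ) with hσ
  have hs' : ∀ i, 1 ≤ i → i < m → 2 ≤ σ i := fun i h1 h2 => by
    have := hs i h1 h2; simp only [hσ]; omega
  obtain ⟨Y, hYR, hYi, hYm, hYd⟩ := exists_maxIndep m hm (Finset.Ico 1 m)
    (fun x hx => (Finset.mem_Ico.1 hx).2) (fun i => σ i - 1)
  obtain ⟨Z, hZR, hZi, hZm, hZd⟩ := exists_maxIndep m hm (Finset.range m)
    (fun x hx => (Finset.mem_range.1 hx)) (fun i => σ i - 1)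
  have hsub : Finset.Ico 1 m ⊆ Finset.range m := fun x hx => by
    simp at hx ⊢; omega
  have hYm' : ∀ i ∈ Y, 1 ≤ i ∧ i < m := fun i hi => Finset.mem_Ico.1 (hYR hi)
  have hZm' : ∀ i ∈ Z, i < m := fun i hi => Finset.mem_range.1 (hZR hi)
  have wR := h.ws (Finset.range m) (fun i hi => Finset.mem_range.1 hi)
  have hsum : ∀ T : Finset ℕ, (∀ i ∈ T, 2 ≤ σ i) → ∑ i ∈ T, σ i = ∑ i ∈ T, (σ i - 1) + T.card := by
    intro T hT
    rw [Finset.card_eq_sum_ones, ← Finset.sum_add_distrib]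
    refine Finset.sum_congr rfl fun i hi => ?_
    have := hT i hi
    omega
  have hYs : ∀ i ∈ Y, 2 ≤ σ i := fun i hi => hs' i (hYm' i hi).1 (hYm' i hi).2
  have hnext : ∀ i < m, (i + 1) % m < m := fun i hi => Nat.mod_lt _ (by omega)
  have hYdom : ∀ x ∈ Finset.Ico 1 m \ Y, ∃ y ∈ Y, cadj m x y := by
    intro x hx
    obtain ⟨hx1, hx2⟩ := Finset.mem_sdiff.1 hx
    refine hYd x hx1 hx2 ?_
    have := hs' x (Finset.mem_Ico.1 hx1).1 (Finset.mem_Ico.1 hx1).2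
    omega
  have hcY : (Finset.Ico 1 m \ Y).card + Y.card = m - 1 := by
    rw [Finset.card_sdiff_add_card_eq_card hYR, Nat.card_Ico]
  have h0Y : 0 ∉ Y := fun hh => by have := hYm' 0 hh; omega
  have hcY2 : (Finset.range m \ Y).card + Y.card = m := by
    rw [Finset.card_sdiff_add_card_eq_card (hYR.trans hsub), Finset.card_range]
  have hcZ : (Finset.range m \ Z).card + Z.card = m := by
    rw [Finset.card_sdiff_add_card_eq_card hZR, Finset.card_range]
  -- sums
  have sdec : ∀ T ⊆ Finset.range m, bight (res D ((((Finset.range m) \ T).image v : Finset V) : Set V)ᶜ)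
      = bight (res D (((Finset.range m).image v : Finset V) : Set V)ᶜ) + ∑ i ∈ T, σ i := by
    intro T hT
    have w2 := h.ws (Finset.range m \ T) (fun i hi => Finset.mem_range.1 (Finset.mem_sdiff.1 hi).1)
    have w3 := Finset.sum_sdiff (f := σ) hT
    simp only [hσ] at w3 ⊢
    omega
  have eS : bight (res D (((Finset.range m).image v : Finset V) : Set V)ᶜ) + m +
      ∑ i ∈ Y, (σ i - 1) ≤ bight (res G {v 0}ᶜ) + 1 := by
    have hun : {0} ∪ (Finset.Ico 1 m \ Y) = Finset.range m \ Y := by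
      ext x
      simp only [Finset.mem_union, Finset.mem_singleton, Finset.mem_sdiff, Finset.mem_Ico,
        Finset.mem_range]
      by_cases hx : x = 0
      · subst hx; simp [h0Y]; omega
      · simp [hx]; omega
    have := h.LBc {0} (Finset.Ico 1 m \ Y) Y (by simp; omega)
      (fun i hi => (Finset.mem_Ico.1 (Finset.mem_sdiff.1 hi).1).2) (fun i hi => (hYm' i hi).2)
      (by simp) Finset.disjoint_sdiff (by simpa using h0Y) (by
        intro i hi
        rw [hun]
        have := hnext i hi
        have hc : cadj m i ((i + 1) % m) := Or.inl rfl
        by_cases h1 : i ∈ Y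
        · right
          refine Finset.mem_sdiff.2 ⟨Finset.mem_range.2 this, fun h2 => hYi _ h1 _ h2 hc⟩
        · exact Or.inl (Finset.mem_sdiff.2 ⟨Finset.mem_range.2 hi, h1⟩)) hYdom
        (fun y hy => hs y (hYm' y hy).1 (hYm' y hy).2)
    rw [hun, sdec Y (hYR.trans hsub), hsum Y hYs] at this
    simp only [Finset.image_singleton, Finset.coe_singleton] at this
    omega
  have full : ∀ T ⊆ Finset.range m, (∀ x ∈ T, ∀ y ∈ T, ¬ cadj m x y) →
      (∀ x ∈ Finset.range m \ T, ∃ y ∈ T, cadj m x y) → (∀ i ∈ T, 2 ≤ σ i) →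
      bight (res D (((Finset.range m).image v : Finset V) : Set V)ᶜ) + m +
      ∑ i ∈ T, (σ i - 1) ≤ bight G := by
    intro T hT hTi hTd hTs
    have hcT : (Finset.range m \ T).card + T.card = m := by
      rw [Finset.card_sdiff_add_card_eq_card hT, Finset.card_range]
    have := h.LBc ∅ (Finset.range m \ T) T (by simp)
      (fun i hi => (Finset.mem_range.1 (Finset.mem_sdiff.1 hi).1))
      (fun i hi => Finset.mem_range.1 (hT hi))
      (by simp) Finset.disjoint_sdiff (by simp) (by
        intro i hi
        rw [Finset.empty_union]
        have := hnext i hi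
        have hc : cadj m i ((i + 1) % m) := Or.inl rfl
        by_cases h1 : i ∈ T
        · right
          refine Finset.mem_sdiff.2 ⟨Finset.mem_range.2 this, fun h2 => hTi _ h1 _ h2 hc⟩
        · exact Or.inl (Finset.mem_sdiff.2 ⟨Finset.mem_range.2 hi, h1⟩)) hTd
        (fun y hy => by have := hTs y hy; simp only [hσ] at this; omega)
    rw [Finset.empty_union, sdec T hT, hsum T hTs] at this
    simp only [Finset.image_empty, Finset.coe_empty, Set.compl_empty, res_univ] at this
    omega
  refine ⟨∑ i ∈ Y, (σ i - 1), ∑ i ∈ Z, (σ i - 1), hZm Y (hYR.trans hsub) hYi, hZm, hYm, eS, ?_⟩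
  change _ + m + ∑ i ∈ Z, (σ i - 1) + min 1 (σ 0) ≤ _
  by_cases h02 : 2 ≤ σ 0
  · have hall : ∀ i < m, 2 ≤ σ i := fun i hi => by
      rcases Nat.eq_zero_or_pos i with rfl | h1
      · exact h02
      · exact hs' i h1 hi
    have := full Z hZR hZi (fun x hx => by
      obtain ⟨hx1, hx2⟩ := Finset.mem_sdiff.1 hx
      have := hall x (Finset.mem_range.1 hx1)
      exact hZd x hx1 hx2 (by omega)) (fun i hi => hall i (hZm' i hi))
    omega
  · have hZY : ∑ i ∈ Z, (σ i - 1) ≤ ∑ i ∈ Y, (σ i - 1) := by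
      have e1 : ∑ i ∈ Z.erase 0, (σ i - 1) = ∑ i ∈ Z, (σ i - 1) :=
        Finset.sum_erase _ (by omega)
      rw [← e1]
      refine hYm _ ?_ fun x hx y hy =>
        hZi x (Finset.mem_of_mem_erase hx) y (Finset.mem_of_mem_erase hy)
      intro x hx
      obtain ⟨hx1, hx2⟩ := Finset.mem_erase.1 hx
      have := hZm' x hx2
      exact Finset.mem_Ico.2 ⟨by omega, this⟩
    by_cases h0n : ∃ y ∈ Y, cadj m 0 y
    · have := full Y (hYR.trans hsub) hYi (fun x hx => by
        obtain ⟨hx1, hx2⟩ := Finset.mem_sdiff.1 hx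
        rcases Nat.eq_zero_or_pos x with rfl | h1
        · exact h0n
        · exact hYdom x (Finset.mem_sdiff.2 ⟨Finset.mem_Ico.2 ⟨h1, Finset.mem_range.1 hx1⟩, hx2⟩))
        hYs
      omega
    · push Not at h0n
      have hXe : Finset.Ico 1 m \ Y = Finset.range m \ (insert 0 Y) := by
        ext x
        simp only [Finset.mem_insert, Finset.mem_sdiff, Finset.mem_Ico, Finset.mem_range]
        by_cases hx : x = 0
        · simp [hx]
        · simp [hx]; omega
      have := h.LBc ∅ (Finset.Ico 1 m \ Y) Y (by simp)
        (fun i hi => (Finset.mem_Ico.1 (Finset.mem_sdiff.1 hi).1).2) (fun i hi => (hYm' i hi).2)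
        (by simp) Finset.disjoint_sdiff (by simp) (by
          intro i hi
          rw [Finset.empty_union, hXe]
          have := hnext i hi
          have hc : cadj m i ((i + 1) % m) := Or.inl rfl
          by_cases h1 : i ∈ insert 0 Y
          · right
            refine Finset.mem_sdiff.2 ⟨Finset.mem_range.2 this, fun h2 => ?_⟩
            rcases Finset.mem_insert.1 h1 with e1 | h1 <;>
              rcases Finset.mem_insert.1 h2 with e2 | h2
            · rw [e2, e1] at hc; exact not_cadj_self hm (by omega) hc
            · rw [e1] at hc h2; exact h0n _ h2 hc
            · rw [e2] at hc; exact h0n _ h1 hc.symm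
            · exact hYi _ h1 _ h2 hc
          · exact Or.inl (Finset.mem_sdiff.2 ⟨Finset.mem_range.2 hi, h1⟩)) hYdom
          (fun y hy => hs y (hYm' y hy).1 (hYm' y hy).2)
      rw [Finset.empty_union, hXe, sdec (insert 0 Y) (Finset.insert_subset (by simp; omega)
        (hYR.trans hsub)), Finset.sum_insert h0Y, hsum Y hYs, ← hXe] at this
      simp only [Finset.image_empty, Finset.coe_empty, Set.compl_empty, res_univ] at this
      omega

end special

section special2

variable [Finite V] {k : Type} [Field k] {G D : SimpleGraph V} {m : ℕ} {v : ℕ → V}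

theorem slot_special (h : CycData G D m v) (IH : ∀ H ≤ D, ∀ b, Slot k H b)
    (hs : ∀ i, 1 ≤ i → i < m → bight (res D {v i}ᶜ) + 2 ≤ bight D) : Slot k G (v 0) := by
  classical
  have hm := h.hm
  obtain ⟨W1, W, hWW, hW, hW1, hc1, hc2⟩ := h.counts hs
  obtain ⟨B, l, hBr, hlr, hBc, hBX, hBG⟩ := SL (k := k) (v 0) ((Finset.range m).image v) D IH (by
    intro a ha b hb hab
    obtain ⟨i, hi, rfl⟩ := Finset.mem_image.1 ha
    obtain ⟨j, hj, rfl⟩ := Finset.mem_image.1 hb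
    exact h.sep i (Finset.mem_range.1 hi) j (Finset.mem_range.1 hj) (by rintro rfl; exact hab rfl))
  have hvJ : ∀ i < m, v i ∈ (Finset.range m).image v := fun i hi =>
    Finset.mem_image_of_mem _ (Finset.mem_range.2 hi)
  set σ : ℕ → ℕ := fun i => bight D - bight (res D {v i}ᶜ) with hσ
  let ed : ℕ → MvPolynomial V k := fun i =>
    MvPolynomial.X (v (i % m)) * MvPolynomial.X (v (i % m + 1))
  have hedr : ∀ i, Rad G (ed i) := fun i => rad_edge (h.adj _ (Nat.mod_lt _ (by omega)))
  have hed : ∀ i < m, ed i = MvPolynomial.X (v i) * MvPolynomial.X (v (i + 1)) := fun i hi => by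
    simp only [ed, Nat.mod_eq_of_lt hi]
  let E : Finset (MvPolynomial V k) :=
    insert (ed 1) ((Finset.Ico 1 m).image fun i => l (v i) 0 + ed (i + 1))
  have hlG : ∀ a j, Rad G (l a j) := fun a j => (hlr a j).mono h.le
  have hEr : ∀ q ∈ E, Rad G q := by
    intro q hq
    rcases Finset.mem_insert.1 hq with rfl | hq
    · exact hedr 1
    · obtain ⟨i, -, rfl⟩ := Finset.mem_image.1 hq
      exact (hlG _ _).add (hedr _)
  have hEc : E.card ≤ m := by
    have e1 := Finset.card_insert_le (ed 1)
      ((Finset.Ico 1 m).image fun i => l (v i) 0 + ed (i + 1))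
    have e2 := Finset.card_image_le (s := Finset.Ico 1 m) (f := fun i => l (v i) 0 + ed (i + 1))
    rw [Nat.card_Ico] at e2
    change (insert (ed 1) ((Finset.Ico 1 m).image fun i => l (v i) 0 + ed (i + 1))).card ≤ m
    omega
  have hmod : ∀ i < m, v ((i + 1) % m) = v (i + 1) := fun i hi => h.vmod hi
  let idx : Finset (Σ _ : ℕ, ℕ) := (Finset.range m).sigma fun i => Finset.Ico 1 (σ i)
  let g : (Σ _ : ℕ, ℕ) → MvPolynomial V k := fun x => l (v x.1) x.2
  have chain : ∀ P : Ideal (MvPolynomial V k), P.IsPrime → (∀ q ∈ B, q ∈ P) → (∀ q ∈ E, q ∈ P) →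
      (∀ i < m, (MvPolynomial.X (v i) * MvPolynomial.X (v (i + 1)) : MvPolynomial V k) ∈ P) ∧
      (∀ i, 1 ≤ i → i < m → l (v i) 0 ∈ P) := by
    intro P hP hB hE
    have step : ∀ i, 1 ≤ i → i < m → ed i ∈ P → ed (i + 1) ∈ P ∧ l (v i) 0 ∈ P := by
      intro i h1 hi hi'
      have hsum : l (v i) 0 + ed (i + 1) ∈ P := hE _ (Finset.mem_insert_of_mem
        (Finset.mem_image.2 ⟨i, Finset.mem_Ico.2 ⟨h1, hi⟩, rfl⟩))
      rw [hed i hi] at hi'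
      rcases hP.mem_or_mem hi' with hx | hx
      · have hf := hBX P hP hB _ (hvJ i hi) hx 0
        exact ⟨(P.add_mem_iff_right hf).1 hsum, hf⟩
      · have he : ed (i + 1) ∈ P := by
          simp only [ed]
          rw [hmod i hi]
          exact P.mul_mem_right _ hx
        exact ⟨he, (P.add_mem_iff_left he).1 hsum⟩
    have all : ∀ i, 1 ≤ i → i ≤ m → ed i ∈ P := by
      intro i h1
      induction i, h1 using Nat.le_induction with
      | base => exact fun _ => hE _ (Finset.mem_insert_self _ _)
      | succ i h1 ih => exact fun hi => (step i h1 (by omega) (ih (by omega))).1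
    refine ⟨fun i hi => ?_, fun i h1 hi => (step i h1 hi (all i h1 hi.le)).2⟩
    rcases Nat.eq_zero_or_pos i with rfl | h1
    · have := all m (by omega) le_rfl
      simpa only [ed, Nat.mod_self] using this
    · have := all i h1 hi.le
      rwa [hed i hi] at this
  have core : ∀ P : Ideal (MvPolynomial V k), P.IsPrime → (∀ q ∈ B, q ∈ P) → (∀ q ∈ E, q ∈ P) →
      (1 ≤ σ 0 → l (v 0) 0 ∈ P) →
      ∀ K, ((∀ Y' ⊆ Finset.range m, (∀ x ∈ Y', MvPolynomial.X (v x) ∉ P) →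
        (∀ x ∈ Y', ∀ y ∈ Y', ¬ cadj m x y) → ∑ i ∈ Y', (σ i - 1) ≤ K)) →
      (∀ j, 1 ≤ j → j ≤ K → esy idx g j ∈ P) → GIn G P := by
    intro P hP hB hE h00 K hK hes
    obtain ⟨hall, hf⟩ := chain P hP hB hE
    have hg : ∀ x ∈ idx, g x ∈ P := by
      let N := (Finset.range m).filter fun i => (MvPolynomial.X (v i) : MvPolynomial V k) ∉ P
      have hNK : ∑ i ∈ N, (σ i - 1) ≤ K := by
        refine hK N (Finset.filter_subset _ _) (fun x hx => (Finset.mem_filter.1 hx).2) ?_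
        have aux : ∀ x ∈ N, ∀ y ∈ N, (x + 1) % m ≠ y := by
          intro x hx y hy he
          have hxm := Finset.mem_range.1 (Finset.mem_filter.1 hx).1
          rcases hP.mem_or_mem (hall x hxm) with h1 | h1
          · exact (Finset.mem_filter.1 hx).2 h1
          · rw [← hmod x hxm, he] at h1
            exact (Finset.mem_filter.1 hy).2 h1
        rintro x hx y hy (hc | hc)
        · exact aux x hx y hy hc
        · exact aux y hy x hx hc
      refine esy_all idx g P hP (N.sigma fun i => Finset.Ico 1 (σ i)) ?_ ?_ ?_
      · exact Finset.sigma_mono (Finset.filter_subset _ _) fun _ => le_rfl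
      · rintro ⟨i, j⟩ hij hn
        obtain ⟨hi, hj⟩ := Finset.mem_sigma.1 hij
        have hiN : i ∉ N := fun hh => hn (Finset.mem_sigma.2 ⟨hh, hj⟩)
        have hX : (MvPolynomial.X (v i) : MvPolynomial V k) ∈ P := by
          by_contra hX
          exact hiN (Finset.mem_filter.2 ⟨hi, hX⟩)
        exact hBX P hP hB _ (hvJ i (Finset.mem_range.1 hi)) hX j
      · intro j h1 h2
        refine hes j h1 (h2.trans ?_)
        rw [Finset.card_sigma]
        simpa only [Nat.card_Ico] using hNK
    have hD : GIn D P := by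
      refine hBG P hP hB fun a ha => Or.inr fun j hj => ?_
      obtain ⟨i, hi, rfl⟩ := Finset.mem_image.1 ha
      have hi' := Finset.mem_range.1 hi
      rcases Nat.eq_zero_or_pos j with rfl | h1
      · rcases Nat.eq_zero_or_pos i with rfl | h2
        · exact h00 hj
        · exact hf i h2 hi'
      · exact hg ⟨i, j⟩ (Finset.mem_sigma.2 ⟨hi, Finset.mem_Ico.2 ⟨h1, hj⟩⟩)
    intro a b hab
    rcases h.edge a b hab with hab' | ⟨i, hi, he⟩
    · exact hD a b hab'
    · rcases Sym2.eq_iff.1 he with ⟨rfl, rfl⟩ | ⟨rfl, rfl⟩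
      · exact hall i hi
      · rw [mul_comm]; exact hall i hi
  have hgr : ∀ j, 1 ≤ j → Rad G (esy idx g j) := fun j hj => esy_rad idx g j hj fun i _ => hlG _ _
  have hnc := h.ncD
  have cS : (B ∪ E ∪ (Finset.Icc 1 W1).image (esy idx g)).card ≤ B.card + m + W1 := by
    have e1 := Finset.card_union_le (B ∪ E) ((Finset.Icc 1 W1).image (esy idx g))
    have e2 := Finset.card_union_le B E
    have e3 := Finset.card_image_le (s := Finset.Icc 1 W1) (f := esy idx g)
    rw [Nat.card_Icc] at e3
    omega
  have cL : ((if 1 ≤ σ 0 then {l (v 0) 0} else ∅) ∪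
      (Finset.Ioc W1 W).image (esy idx g)).card ≤ min 1 (σ 0) + (W - W1) := by
    have e1 := Finset.card_union_le (if 1 ≤ σ 0 then {l (v 0) 0} else ∅)
      ((Finset.Ioc W1 W).image (esy idx g))
    have e3 := Finset.card_image_le (s := Finset.Ioc W1 W) (f := esy idx g)
    rw [Nat.card_Ioc] at e3
    have e4 : (if 1 ≤ σ 0 then {l (v 0) 0} else ∅ : Finset (MvPolynomial V k)).card
        ≤ min 1 (σ 0) := by
      split_ifs with h1
      · rw [Finset.card_singleton]; omega
      · simp
    omega
  refine Slot.mk' (B ∪ E ∪ (Finset.Icc 1 W1).image (esy idx g))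
    ((if 1 ≤ σ 0 then {l (v 0) 0} else ∅) ∪ (Finset.Ioc W1 W).image (esy idx g)) ?_ ?_ ?_ ?_ ?_ ?_
  · intro q hq
    rcases Finset.mem_union.1 hq with hq | hq
    · rcases Finset.mem_union.1 hq with hq | hq
      · exact (hBr q hq).mono h.le
      · exact hEr q hq
    · obtain ⟨j, hj, rfl⟩ := Finset.mem_image.1 hq
      exact hgr j (Finset.mem_Icc.1 hj).1
  · intro q hq
    rcases Finset.mem_union.1 hq with hq | hq
    · split_ifs at hq
      · rw [Finset.mem_singleton.1 hq]; exact hlG _ _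
      · simp at hq
    · obtain ⟨j, hj, rfl⟩ := Finset.mem_image.1 hq
      have := (Finset.mem_Ioc.1 hj).1
      exact hgr j (by omega)
  · omega
  · have : min 1 (σ 0) = min 1 (bight D - bight (res D {v 0}ᶜ)) := rfl
    omega
  · intro P hP hS hX0
    have hB : ∀ q ∈ B, q ∈ P := fun q hq =>
      hS q (Finset.mem_union_left _ (Finset.mem_union_left _ hq))
    refine core P hP hB (fun q hq => hS q (Finset.mem_union_left _ (Finset.mem_union_right _ hq)))
      (fun _ => hBX P hP hB _ (hvJ 0 (by omega)) hX0 0) W1 ?_ ?_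
    · intro Y hY hYX hYi
      refine hW1 Y (fun x hx => ?_) hYi
      have := Finset.mem_range.1 (hY hx)
      rcases Nat.eq_zero_or_pos x with rfl | h1
      · exact absurd hX0 (hYX 0 hx)
      · exact Finset.mem_Ico.2 ⟨h1, this⟩
    · intro j h1 h2
      exact hS _ (Finset.mem_union_right _ (Finset.mem_image_of_mem _ (Finset.mem_Icc.2 ⟨h1, h2⟩)))
  · intro P hP hS hL
    have hB : ∀ q ∈ B, q ∈ P := fun q hq =>
      hS q (Finset.mem_union_left _ (Finset.mem_union_left _ hq))
    refine core P hP hB (fun q hq => hS q (Finset.mem_union_left _ (Finset.mem_union_right _ hq)))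
      (fun h1 => hL _ (Finset.mem_union_left _ (by rw [if_pos h1]; simp))) W ?_ ?_
    · intro Y hY _ hYi
      exact hW Y hY hYi
    · intro j h1 h2
      by_cases h3 : j ≤ W1
      · exact hS _ (Finset.mem_union_right _
          (Finset.mem_image_of_mem _ (Finset.mem_Icc.2 ⟨h1, h3⟩)))
      · exact hL _ (Finset.mem_union_right _
          (Finset.mem_image_of_mem _ (Finset.mem_Ioc.2 ⟨by omega, h2⟩)))

end special2

section main

variable [Finite V] {k : Type} [Field k]

theorem exists_leaf {G : SimpleGraph V} (hG : G.IsAcyclic) {a b : V} (hab : G.Adj a b) :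
    ∃ u w, ∀ x, G.Adj u x ↔ x = w := by
  have : Nonempty V := ⟨a⟩
  obtain ⟨u, v, p, hp, hmax⟩ := SimpleGraph.Walk.exists_isPath_forall_isPath_length_le_length G
  have hnil : ¬ p.Nil := by
    intro hn
    have h1 := hmax a b (Path.singleton hab : G.Path a b) (Path.singleton hab).2
    rw [← Walk.length_eq_zero_iff] at hn
    rw [hn] at h1
    simp [Path.singleton] at h1
  refine ⟨u, p.snd, fun x => ⟨fun hx => ?_, fun hx => hx ▸ p.adj_snd hnil⟩⟩
  apply hG.eq_snd_of_adj_start hp hx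
  by_contra hs
  have := hmax _ _ (p.cons hx.symm) (hp.cons hs)
  rw [Walk.length_cons] at this
  omega

variable (k) in
theorem slot_main : ∀ (n : ℕ) (G : SimpleGraph V), G.edgeSet.ncard = n →
    CyclesPairwiseDisjoint G → ∀ w, Slot k G w := by
  intro n
  induction n using Nat.strong_induction_on with
  | _ n ih =>
  intro G hn hG
  have IH : ∀ H ≤ G, ∀ a b, G.Adj a b → ¬ H.Adj a b → ∀ w, Slot k H w := fun H hH a b h1 h2 =>
    ih _ (by rw [← hn]; exact edges_lt hH h1 h2) H rfl (CPD.mono hH hG)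
  -- case of a vertex on a cycle
  have c1 : ∀ (w : V) (c : G.Walk w w), c.IsCycle → Slot k G w := by
    intro w c hc
    obtain ⟨D, m, v, h, rfl⟩ := exists_cycData hG c hc
    have hm := h.hm
    have IH1 : ∀ j < m, Slot k (G.deleteEdges {s(v j, v (j + 1))}) (v 0) := fun j hj =>
      IH _ (deleteEdges_le _) (v j) (v (j + 1)) (h.adj j hj) (by simp) _
    by_cases hz : ∃ i, 1 ≤ i ∧ i < m ∧ bight D ≤ bight (res D {v i}ᶜ)
    · obtain ⟨i, h1, hi, h2⟩ := hz
      exact slot_break h h1 hi IH1 (Or.inl h2)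
    · push Not at hz
      by_cases ho : ∃ i, 1 ≤ i ∧ i < m ∧ bight D ≤ bight (res D {v i}ᶜ) + 1
      · obtain ⟨i, h1, hi, h2⟩ := ho
        exact slot_break h h1 hi IH1 (Or.inr ⟨h2, hz⟩)
      · push Not at ho
        refine slot_special h (fun H hH b => IH H (hH.trans h.le) (v 0) (v (0 + 1))
          (h.adj 0 (by omega)) (fun hh => h.notD 0 (by omega) (hH hh)) b) ho
  -- case of positive gain
  have c2 : ∀ w : V, bight (res G {w}ᶜ) + 1 ≤ bight G → Slot k G w := by
    intro w hw
    by_cases hcyc : ∃ c : G.Walk w w, c.IsCycle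
    · obtain ⟨c, hc⟩ := hcyc
      exact c1 w c hc
    · have hbr : ∀ z, ∃ U : Set V, G.Adj w z → z ∈ U ∧ w ∉ U ∧
          ∀ u v, G.Adj u v → u ∈ U → v ∉ U → u = z ∧ v = w := by
        intro z
        by_cases hz : G.Adj w z
        · obtain ⟨U, hU⟩ := bridge_struct hz (by
            intro u c hc he
            exact hcyc (mem_edge_of_support c hc (c.fst_mem_support_of_mem_edges he)))
          exact ⟨U, fun _ => hU⟩
        · exact ⟨∅, fun h => absurd h hz⟩
      choose U hU using hbr
      by_cases hex : ∃ z, G.Adj w z ∧ bight (res G (U z ∩ {z}ᶜ)) + 1 ≤ bight (res G (U z))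
      · obtain ⟨z, hz, hs⟩ := hex
        obtain ⟨h1, h2, h3⟩ := hU z hz
        exact slot_bridge hz h1 h2 h3 (IH (res G (U z)ᶜ) (res_le _ _) w z hz (fun h => h.2.2 h1) w)
          (IH (res G (U z)) (res_le _ _) w z hz (fun h => h2 h.2.1) z) hs hw
      · push Not at hex
        by_cases hnb : ∃ z, G.Adj w z
        · obtain ⟨z, hz⟩ := hnb
          refine slot_Z (w' := w) (IH (res G {w}ᶜ) (res_le _ _) w z hz (fun h => h.2.1 rfl) w)
            (Z_hyp U (fun z hz => (hU z hz).1) (fun z hz => (hU z hz).2.1)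
              (fun z hz => (hU z hz).2.2) (fun z hz => Nat.lt_succ_iff.1 (hex z hz)))
        · exfalso
          have : res G {w}ᶜ = G := by
            ext a b
            refine ⟨fun h => h.1, fun h => ⟨h, ?_, ?_⟩⟩
            · rintro rfl; exact hnb ⟨b, h⟩
            · rintro rfl; exact hnb ⟨a, h.symm⟩
          rw [this] at hw
          omega
  intro w
  by_cases hw : bight (res G {w}ᶜ) + 1 ≤ bight G
  · exact c2 w hw
  · by_cases hac : G.IsAcyclic
    · by_cases he : ∃ a b, G.Adj a b
      · obtain ⟨a, b, hab⟩ := he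
        obtain ⟨u, w', hu⟩ := exists_leaf hac hab
        exact slot_of_eq (c2 w' (leaf_gain hu)) (by omega)
      · push Not at he
        exact slot_of_no_edges he
    · unfold SimpleGraph.IsAcyclic at hac
      push Not at hac
      obtain ⟨u, c, hc⟩ := hac
      exact slot_of_eq (c1 u c hc) (by omega)

theorem ara_bound (G : SimpleGraph V) (hG : CyclesPairwiseDisjoint G) :
    ara k G ≤ bight G + nc G := by
  rcases isEmpty_or_nonempty V with hV | ⟨⟨w⟩⟩
  · refine (ara_le (k := k) G ∅ (by simp) ?_).trans (by simp)
    intro P _ _ u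
    exact hV.elim u
  · obtain ⟨Q, h1, h2, h3⟩ := (slot_main k _ G rfl hG w).total
    exact (ara_le G Q h1 h3).trans h2

end main

/-- For a finite simple graph whose cycles are pairwise vertex-disjoint, the
arithmetical rank of the edge ideal is at most the big height plus the number
of cycles. -/
theorem stmt0 {V : Type} [Fintype V] (k : Type) [Field k] (G : SimpleGraph V)
    (hG : CyclesPairwiseDisjoint G) :
    ara k G ≤ bight G +
      Set.ncard {s : Set (Sym2 V) |
        ∃ (u : V) (c : G.Walk u u), c.IsCycle ∧ s = {e | e ∈ c.edges}} := by
  exact ara_bound G hG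
end

section
/- Let G be a finite simple graph with no cycles (an acyclic graph, i.e., a forest). Then the arithmetical rank of the edge ideal I(G) equals its big height: ara I(G) = bight I(G). -/
open SimpleGraph

variable {V : Type}

/-- `S` is a maximal independent set of `G`. -/
def MIS (G : SimpleGraph V) (S : Set V) : Prop :=
  (∀ x ∈ S, ∀ y ∈ S, ¬ G.Adj x y) ∧ ∀ x, x ∉ S → ∃ y ∈ S, G.Adj x y

/-- `x` is a leaf of `G` with unique neighbour `u`. -/
def Leaf (G : SimpleGraph V) (x u : V) : Prop := G.Adj x u ∧ ∀ y, G.Adj x y → y = u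

/-- every nonempty subgraph has a leaf -/
def HL (G : SimpleGraph V) : Prop := ∀ G' : SimpleGraph V, G' ≤ G → G' ≠ ⊥ → ∃ x u, Leaf G' x u

lemma MIS.isMinVC {G : SimpleGraph V} {S : Set V} (h : MIS G S) : IsMinVC G Sᶜ := by
  refine ⟨fun u v huv => ?_, fun D hD hDc => ?_⟩
  · by_contra hc
    push Not at hc
    exact h.1 u (by simpa using hc.1) v (by simpa using hc.2) huv
  · obtain ⟨x, hx, hxD⟩ := Set.exists_of_ssubset hD
    obtain ⟨y, hy, hxy⟩ := h.2 x hx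
    rcases hDc hxy with h1 | h1
    · exact hxD h1
    · exact hD.1 h1 hy

lemma swap [Finite V] {G G' : SimpleGraph V} {S : Set V} (hS : MIS G' S) (hle : G' ≤ G)
    (A : Set V) (l : V → V) (hA : ∀ a ∈ A, ∀ b ∈ A, ¬ G.Adj a b)
    (hl : ∀ a ∈ A, Leaf G (l a) a) (v : V) (hv : v ∈ A) (hvl : ¬ G'.Adj v (l v))
    (hrem : ∀ x y, G.Adj x y → ¬ G'.Adj x y → (∃ a ∈ A, G.Adj a x) ∨ ∃ a ∈ A, G.Adj a y)
    (hdom : ∀ y ∈ S, (∃ a ∈ A, G.Adj a y) → ∀ x, G'.Adj y x → x ∈ A ∨ ∃ a ∈ A, G.Adj a x) :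
    ∃ T, MIS G T ∧ T.ncard + 1 ≤ S.ncard := by
  classical
  let T : Set V := {x | x ∈ A ∨ (x ∈ S ∧ ¬ ∃ a ∈ A, G.Adj a x)}
  refine ⟨T, ⟨?_, ?_⟩, ?_⟩
  · rintro x (hx | ⟨hx, hx'⟩) y (hy | ⟨hy, hy'⟩) hxy
    · exact hA x hx y hy hxy
    · exact hy' ⟨x, hx, hxy⟩
    · exact hx' ⟨y, hy, hxy.symm⟩
    · by_cases h : G'.Adj x y
      · exact hS.1 x hx y hy h
      · rcases hrem x y hxy h with h | h
        · exact hx' h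
        · exact hy' h
  · intro x hx
    have hxA : x ∉ A := fun h => hx (Or.inl h)
    by_cases hxN : ∃ a ∈ A, G.Adj a x
    · obtain ⟨a, ha, hax⟩ := hxN
      exact ⟨a, Or.inl ha, hax.symm⟩
    · have hxS : x ∉ S := fun h => hx (Or.inr ⟨h, hxN⟩)
      obtain ⟨y, hy, hxy⟩ := hS.2 x hxS
      refine ⟨y, Or.inr ⟨hy, fun hyN => ?_⟩, hle hxy⟩
      rcases hdom y hy hyN x hxy.symm with h | h
      · exact hxA h
      · exact hxN h
  · have hlS : ∀ a ∈ A, a ∉ S → l a ∈ S := by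
      intro a ha haS
      by_contra h
      obtain ⟨y, hy, hxy⟩ := hS.2 _ h
      have := (hl a ha).2 y (hle hxy)
      exact haS (this ▸ hy)
    have hvS : l v ∈ S := by
      by_contra h
      obtain ⟨y, hy, hxy⟩ := hS.2 _ h
      have := (hl v hv).2 y (hle hxy)
      subst this
      exact hvl hxy.symm
    obtain ⟨y, hyS, hyN, hyv⟩ : ∃ y ∈ S, G.Adj v y ∧ (v ∈ S ∧ y = l v ∨ v ∉ S ∧ y ≠ l v) := by
      by_cases h : v ∈ S
      · exact ⟨l v, hvS, (hl v hv).1.symm, Or.inl ⟨h, rfl⟩⟩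
      · obtain ⟨y, hy, hxy⟩ := hS.2 _ h
        refine ⟨y, hy, hle hxy, Or.inr ⟨h, ?_⟩⟩
        rintro rfl
        exact hvl hxy
    let f : V → V := fun x => if x ∈ S then x else l x
    have key : T.ncard ≤ (S \ {y}).ncard := by
      apply Set.ncard_le_ncard_of_injOn f
      · rintro x (hx | ⟨hx, hx'⟩)
        · by_cases hxS : x ∈ S
          · simp only [f, hxS, if_true]
            refine ⟨hxS, ?_⟩
            rintro rfl
            exact hA v hv x hx hyN
          · simp only [f, hxS, if_false]
            refine ⟨hlS x hx hxS, ?_⟩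
            intro h
            have h : l x = y := h
            have : v = x := (hl x hx).2 v (h ▸ hyN.symm)
            subst this
            rcases hyv with h1 | h1
            · exact hxS h1.1
            · exact h1.2 h.symm
        · simp only [f, hx, if_true]
          refine ⟨hx, ?_⟩
          rintro rfl
          exact hx' ⟨v, hv, hyN⟩
      · rintro x hx z hz hxz
        have aux : ∀ x ∈ T, ∀ z ∈ T, x ∈ S → z ∉ S → x ≠ l z := by
          intro x hx z hz hxS hzS h
          have hzA : z ∈ A := hz.resolve_right (fun h => hzS h.1)
          have := (hl z hzA).1
          rw [← h] at this
          rcases hx with hx | hx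
          · exact hA _ hx _ hzA this
          · exact hx.2 ⟨z, hzA, this.symm⟩
        by_cases h1 : x ∈ S <;> by_cases h2 : z ∈ S <;> simp only [f, h1, h2, if_true, if_false] at hxz
        · exact hxz
        · exact absurd hxz (aux x hx z hz h1 h2)
        · exact absurd hxz.symm (aux z hz x hx h2 h1)
        · have hzA : z ∈ A := hz.resolve_right (fun h => h2 h.1)
          have hxA : x ∈ A := hx.resolve_right (fun h => h1 h.1)
          exact (hl z hzA).2 x (hxz ▸ (hl x hxA).1)
    have := Set.ncard_sdiff_singleton_add_one hyS (Set.toFinite S)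
    omega

/-- delete all edges at leaves -/
def peel (G : SimpleGraph V) : SimpleGraph V where
  Adj x y := G.Adj x y ∧ (¬ ∃ u, Leaf G x u) ∧ ¬ ∃ u, Leaf G y u
  symm := ⟨fun _ _ h => ⟨h.1.symm, h.2.2, h.2.1⟩⟩
  loopless := ⟨fun _ h => G.loopless.irrefl _ h.1⟩

lemma peel_le (G : SimpleGraph V) : peel G ≤ G := fun _ _ h => h.1

lemma peel_leaf {G : SimpleGraph V} {u w : V} (h : Leaf (peel G) u w) :
    (∃ m, m ≠ w ∧ Leaf G m u) ∧ ∀ y, G.Adj u y → y = w ∨ Leaf G y u := by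
  obtain ⟨⟨h1, h2, h3⟩, h4⟩ := h
  have h5 : ∀ y, G.Adj u y → y = w ∨ Leaf G y u := by
    intro y hy
    by_cases hyw : y = w
    · exact Or.inl hyw
    · by_cases hL : ∃ t, Leaf G y t
      · obtain ⟨t, ht⟩ := hL
        have := ht.2 u hy.symm
        exact Or.inr (this ▸ ht)
      · exact absurd (h4 y ⟨hy, h2, hL⟩) hyw
  refine ⟨?_, h5⟩
  by_contra hc
  push Not at hc
  apply h2
  refine ⟨w, h1, fun y hy => ?_⟩
  by_contra hyw
  exact hc y hyw ((h5 y hy).resolve_left hyw)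

lemma HL.mono {G G' : SimpleGraph V} (h : HL G) (hle : G' ≤ G) : HL G' :=
  fun K hK hb => h K (hK.trans hle) hb

lemma forest_end {G : SimpleGraph V} (h : HL G) (hb : G ≠ ⊥) :
    ∃ v l, Leaf G l v ∧ ((∀ y, G.Adj v y → Leaf G y v) ∨
      ∃ w, (peel G).Adj v w ∧ ∀ y, G.Adj v y → y = w ∨ Leaf G y v) := by
  by_cases hp : peel G = ⊥
  · obtain ⟨l, v, hl⟩ := h G le_rfl hb
    by_cases hv : ∃ u, Leaf G v u
    · obtain ⟨u, hu⟩ := hv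
      have := hu.2 l hl.1.symm
      subst this
      refine ⟨v, l, hl, Or.inl fun y hy => ?_⟩
      rw [hu.2 y hy]; exact hl
    · refine ⟨v, l, hl, Or.inl fun y hy => ?_⟩
      by_cases hL : ∃ t, Leaf G y t
      · obtain ⟨t, ht⟩ := hL
        have := ht.2 v hy.symm
        exact (this ▸ ht)
      · have : (peel G).Adj v y := ⟨hy, hv, hL⟩
        rw [hp] at this
        exact this.elim
  · obtain ⟨v, w, hv⟩ := h (peel G) (peel_le G) hp
    obtain ⟨⟨m, -, hm⟩, h2⟩ := peel_leaf hv
    exact ⟨v, m, hm, Or.inr ⟨w, hv.1, h2⟩⟩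

lemma forest_cases {G : SimpleGraph V} (h : HL G) (hb : G ≠ ⊥) :
    (∃ v l, Leaf G l v ∧ ∀ y, G.Adj v y → Leaf G y v) ∨
    (∃ v w l t, Leaf G l v ∧ l ≠ w ∧ G.Adj v w ∧ (∀ y, G.Adj v y → y = w ∨ Leaf G y v) ∧
      Leaf G t w) ∨
    (∃ v w l z, Leaf G l v ∧ l ≠ w ∧ G.Adj v w ∧ G.Adj w z ∧ z ≠ v ∧
      ∀ u, G.Adj w u → u = z ∨
        ((∃ m, m ≠ w ∧ Leaf G m u) ∧ ∀ y, G.Adj u y → y = w ∨ Leaf G y u)) := by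
  obtain ⟨v, l, hl, h0 | ⟨w, hw, h0⟩⟩ := forest_end h hb
  · exact Or.inl ⟨v, l, hl, h0⟩
  have hp : peel G ≠ ⊥ := by
    intro hp; rw [hp] at hw; exact hw
  obtain ⟨c, v, hv, h1⟩ := forest_end (h.mono (peel_le G)) hp
  obtain ⟨⟨m, hmc, hm⟩, hvN⟩ := peel_leaf hv
  have hcL := hv.1.2.2
  refine Or.inr ?_
  by_cases ht : ∃ t, Leaf G t c
  · obtain ⟨t, ht⟩ := ht
    exact Or.inl ⟨v, c, m, t, hm, hmc, hv.1.1, hvN, ht⟩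
  refine Or.inr ?_
  have hcN : ∀ u, G.Adj c u → (peel G).Adj c u := by
    intro u hu
    refine ⟨hu, hcL, ?_⟩
    rintro ⟨t, htu⟩
    have := htu.2 c hu.symm
    exact ht ⟨u, this ▸ htu⟩
  rcases h1 with h1 | ⟨z, hz, h1⟩
  · obtain ⟨z, hz, hzv⟩ : ∃ z, G.Adj c z ∧ z ≠ v := by
      by_contra hc
      push Not at hc
      exact hcL ⟨v, hv.1.1.symm, hc⟩
    exact ⟨v, c, m, z, hm, hmc, hv.1.1, hz, hzv, fun u hu => Or.inr (peel_leaf (h1 u (hcN u hu)))⟩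
  · refine ⟨v, c, m, z, hm, hmc, hv.1.1, hz.1.1, ?_, fun u hu => ?_⟩
    · rintro rfl
      exact hz.2.2 ⟨c, hv⟩
    · rcases h1 u (hcN u hu) with h2 | h2
      · exact Or.inl h2
      · exact Or.inr (peel_leaf h2)

lemma acyclic_HL [Finite V] {G : SimpleGraph V} (h : G.IsAcyclic) : HL G := by
  classical
  intro K hK hb
  have hac : K.IsAcyclic := h.anti hK
  obtain ⟨a, b, hab⟩ := SimpleGraph.ne_bot_iff_exists_adj.1 hb
  have : Nonempty V := ⟨a⟩
  have ⟨u, v, p, hp, hmax⟩ := Walk.exists_isPath_forall_isPath_length_le_length K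
  have hnil : ¬p.Nil := by
    have := hmax _ _ (Path.singleton hab).1 (Path.singleton hab).2
    intro hn
    have h0 := Walk.length_eq_zero_iff.2 hn
    simp [Path.singleton] at this
    omega
  refine ⟨u, _, p.adj_snd hnil, fun w hadj ↦ ?_⟩
  apply hac.eq_snd_of_adj_start hp hadj
  by_contra hw
  have h1 : (p.cons hadj.symm).IsPath := hp.cons hw
  have := hmax _ _ _ h1
  simp at this

open MvPolynomial in
lemma primeX_isPrime (k : Type) [Field k] (C : Set V) :
    (Ideal.span (X '' C : Set (MvPolynomial V k))).IsPrime := by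
  classical
  let φ : MvPolynomial V k →ₐ[k] MvPolynomial V k := aeval fun v => if v ∈ C then 0 else X v
  have hker : Ideal.span (X '' C : Set (MvPolynomial V k)) = RingHom.ker φ := by
    apply le_antisymm
    · rw [Ideal.span_le]
      rintro _ ⟨v, hv, rfl⟩
      simp [φ, hv]
    · intro f hf
      have h2 : (Ideal.Quotient.mkₐ k (Ideal.span (X '' C : Set (MvPolynomial V k)))).comp φ
          = Ideal.Quotient.mkₐ k _ := by
        apply MvPolynomial.algHom_ext
        intro v
        by_cases hv : v ∈ C
        · simp only [AlgHom.comp_apply, φ, aeval_X, hv, if_true, map_zero]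
          symm
          exact Ideal.Quotient.eq_zero_iff_mem.2 (Ideal.subset_span ⟨v, hv, rfl⟩)
        · simp [φ, hv]
      have h3 := AlgHom.congr_fun h2 f
      rw [AlgHom.comp_apply, (show φ f = 0 from hf), map_zero] at h3
      exact Ideal.Quotient.eq_zero_iff_mem.1 h3.symm
  rw [hker]
  exact RingHom.ker_isPrime _

open MvPolynomial in
lemma edgeIdeal_le_iff_s1 (k : Type) [Field k] (G : SimpleGraph V) (J : Ideal (MvPolynomial V k)) :
    edgeIdeal k G ≤ J ↔ ∀ u v, G.Adj u v → X u * X v ∈ J := by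
  unfold edgeIdeal
  rw [Ideal.span_le]
  constructor
  · intro h u v huv
    exact h ⟨u, v, huv, rfl⟩
  · rintro h _ ⟨u, v, huv, rfl⟩
    exact h u v huv

open MvPolynomial in
lemma edge_mem (k : Type) [Field k] (G : SimpleGraph V) {u v : V} (h : G.Adj u v) :
    X u * X v ∈ edgeIdeal k G := (edgeIdeal_le_iff_s1 k G _).1 le_rfl u v h

open MvPolynomial in
lemma edgeIdeal_le_prime (k : Type) [Field k] (G : SimpleGraph V) {C : Set V} (hC : IsVC G C) :
    edgeIdeal k G ≤ Ideal.span (X '' C : Set (MvPolynomial V k)) := by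
  rw [edgeIdeal_le_iff_s1]
  intro u v huv
  rcases hC huv with h | h
  · exact Ideal.mul_mem_right _ _ (Ideal.subset_span ⟨u, h, rfl⟩)
  · exact Ideal.mul_mem_left _ _ (Ideal.subset_span ⟨v, h, rfl⟩)

open MvPolynomial in
lemma edgeIdeal_radical (k : Type) [Field k] (G : SimpleGraph V) :
    (edgeIdeal k G).IsRadical := by
  classical
  rintro f ⟨n, hn⟩
  have hE : edgeIdeal k G = Ideal.span ((fun s => monomial s (1 : k)) ''
      {s | ∃ u v : V, G.Adj u v ∧ s = Finsupp.single u 1 + Finsupp.single v 1}) := by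
    unfold edgeIdeal
    congr 1
    ext p
    constructor
    · rintro ⟨u, v, huv, rfl⟩
      exact ⟨_, ⟨u, v, huv, rfl⟩, by simp [X, monomial_mul]⟩
    · rintro ⟨_, ⟨u, v, huv, rfl⟩, rfl⟩
      exact ⟨u, v, huv, by simp [X, monomial_mul]⟩
  rw [hE, mem_ideal_span_monomial_image]
  intro m hm
  by_contra hc
  have hVC : IsVC G {v | m v = 0} := by
    intro u v huv
    by_contra h
    simp only [Set.mem_ofPred_eq, not_or] at h
    refine hc ⟨_, ⟨u, v, huv, rfl⟩, ?_⟩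
    intro x
    have hne : u ≠ v := huv.ne
    simp only [Finsupp.add_apply, Finsupp.single_apply]
    split_ifs with h1 h2 h2
    · exact absurd (h1.trans h2.symm) hne
    · subst h1; omega
    · subst h2; omega
    · omega
  have hfP := (primeX_isPrime k {v | m v = 0}).mem_of_pow_mem n (edgeIdeal_le_prime k G hVC hn)
  rw [mem_ideal_span_X_image] at hfP
  obtain ⟨i, hi, hi'⟩ := hfP m hm
  exact hi' hi

open MvPolynomial in
lemma ncard_le_height [Finite V] (k : Type) [Field k] (C : Set V) :
    (C.ncard : ℕ∞) ≤ (Ideal.span (X '' C : Set (MvPolynomial V k))).height := by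
  classical
  induction C, Set.toFinite C using Set.Finite.induction_on with
  | empty => simp
  | @insert a s ha hs ih =>
    rw [Set.ncard_insert_of_notMem ha hs]
    have h1 := primeX_isPrime k s
    have h2 := primeX_isPrime k (insert a s)
    have hlt : Ideal.span (X '' s : Set (MvPolynomial V k)) <
        Ideal.span (X '' (insert a s) : Set (MvPolynomial V k)) := by
      refine lt_of_le_of_ne (Ideal.span_mono (Set.image_mono (Set.subset_insert _ _))) ?_
      intro h
      have : (X a : MvPolynomial V k) ∈ Ideal.span (X '' s : Set (MvPolynomial V k)) := by
        rw [h]; exact Ideal.subset_span ⟨a, Set.mem_insert _ _, rfl⟩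
      rw [mem_ideal_span_X_image] at this
      obtain ⟨i, hi, hi'⟩ := this (Finsupp.single a 1) (by rw [support_X]; simp)
      rw [Finsupp.single_apply] at hi'
      split_ifs at hi' with h3
      · exact ha (h3 ▸ hi)
      · exact hi' rfl
    push_cast
    exact (add_le_add_left ih 1).trans (Ideal.height_add_one_le_of_lt_of_isPrime hlt)

open MvPolynomial in
lemma lower_bound [Finite V] (k : Type) [Field k] (G : SimpleGraph V) {C : Set V}
    (hC : IsMinVC G C) {r : ℕ} {q : Fin r → MvPolynomial V k}
    (hq : (Ideal.span (Set.range q)).radical = edgeIdeal k G) : C.ncard ≤ r := by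
  have hP := primeX_isPrime k C
  have hmin : Ideal.span (X '' C : Set (MvPolynomial V k)) ∈
      (Ideal.span (Set.range q)).minimalPrimes := by
    refine ⟨⟨hP, ?_⟩, ?_⟩
    · exact Ideal.le_radical.trans (hq.le.trans (edgeIdeal_le_prime k G hC.1))
    · rintro Q ⟨hQ, hJQ⟩ hQP
      have hIQ : edgeIdeal k G ≤ Q := hq ▸ (hQ.radical_le_iff.2 hJQ)
      have hD : IsVC G {v | (X v : MvPolynomial V k) ∈ Q} := by
        intro u v huv
        exact hQ.mem_or_mem (hIQ (edge_mem k G huv))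
      have hDC : {v | (X v : MvPolynomial V k) ∈ Q} ⊆ C := by
        intro v hv
        have := hQP hv
        rw [mem_ideal_span_X_image] at this
        obtain ⟨i, hi, hi'⟩ := this (Finsupp.single v 1) (by rw [support_X]; simp)
        classical
        rw [Finsupp.single_apply] at hi'
        split_ifs at hi' with h3
        · exact h3 ▸ hi
        · exact absurd rfl hi'
      have hEq : {v | (X v : MvPolynomial V k) ∈ Q} = C := by
        by_contra hne
        exact hC.2 _ (lt_of_le_of_ne hDC hne) hD
      rw [Ideal.span_le]
      rintro _ ⟨v, hv, rfl⟩
      rw [← hEq] at hv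
      exact hv
  have h1 := Ideal.height_le_card_of_mem_minimalPrimes_span (Set.finite_range q) hmin
  have h2 := (ncard_le_height k C).trans h1
  have h3 : (Set.range q).ncard ≤ r := by
    have := Set.ncard_image_le (f := q) (s := Set.univ) Set.finite_univ
    simpa [Set.ncard_univ] using this
  exact le_trans (by exact_mod_cast h2) h3

/-- the inductive claim -/
def Good (k : Type) [Field k] (G : SimpleGraph V) : Prop :=
  ∃ S : Set V, MIS G S ∧ ∃ Q : Set (MvPolynomial V k), Q.Finite ∧ Q.ncard ≤ Sᶜ.ncard ∧
    Q ⊆ edgeIdeal k G ∧ edgeIdeal k G ≤ (Ideal.span Q).radical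

lemma Good.step [Finite V] {k : Type} [Field k] {G G' : SimpleGraph V} (hle : G' ≤ G)
    (hG : Good k G') (p : MvPolynomial V k) (hp : p ∈ edgeIdeal k G)
    (hrad : ∀ J : Ideal (MvPolynomial V k), J.IsRadical → edgeIdeal k G' ≤ J → p ∈ J →
      edgeIdeal k G ≤ J)
    (hS : ∀ S, MIS G' S → ∃ T, MIS G T ∧ T.ncard + 1 ≤ S.ncard) : Good k G := by
  obtain ⟨S, hSM, Q, hQf, hQc, hQI, hIQ⟩ := hG
  obtain ⟨T, hT, hTS⟩ := hS S hSM
  refine ⟨T, hT, insert p Q, hQf.insert p, ?_, ?_, ?_⟩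
  · have h1 := Set.ncard_insert_le p Q
    have h2 := Set.ncard_add_ncard_compl T
    have h3 := Set.ncard_add_ncard_compl S
    omega
  · rw [Set.insert_subset_iff]
    refine ⟨hp, hQI.trans ?_⟩
    change edgeIdeal k G' ≤ edgeIdeal k G
    rw [edgeIdeal_le_iff_s1]
    exact fun u v huv => edge_mem k G (hle huv)
  · apply hrad _ (Ideal.radical_isRadical _)
    · exact hIQ.trans (Ideal.radical_mono (Ideal.span_mono (Set.subset_insert _ _)))
    · exact Ideal.le_radical (Ideal.subset_span (Set.mem_insert _ _))

open MvPolynomial in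
lemma Good.step_one [Finite V] {k : Type} [Field k] {G : SimpleGraph V} {a b : V}
    (hab : G.Adj a b) (hG : Good k (G.deleteEdges {s(a, b)}))
    (hS : ∀ S, MIS (G.deleteEdges {s(a, b)}) S → ∃ T, MIS G T ∧ T.ncard + 1 ≤ S.ncard) :
    Good k G := by
  refine Good.step (G.deleteEdges_le _) hG (X a * X b) (edge_mem k G hab) ?_ hS
  intro J hJ hIJ hp
  rw [edgeIdeal_le_iff_s1] at hIJ ⊢
  intro u v huv
  by_cases h : s(u, v) = s(a, b)
  · rw [Sym2.eq_iff] at h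
    rcases h with ⟨rfl, rfl⟩ | ⟨rfl, rfl⟩
    · exact hp
    · rwa [mul_comm]
  · exact hIJ u v (by simp [SimpleGraph.deleteEdges_adj, huv]; simpa using h)

open MvPolynomial in
lemma Good.step_two [Finite V] {k : Type} [Field k] {G : SimpleGraph V} {v l w z : V}
    (hvl : G.Adj v l) (hwz : G.Adj w z) (hvw : G.Adj v w) (hlw : l ≠ w) (hzv : z ≠ v)
    (hG : Good k (G.deleteEdges {s(v, l), s(w, z)}))
    (hS : ∀ S, MIS (G.deleteEdges {s(v, l), s(w, z)}) S →
      ∃ T, MIS G T ∧ T.ncard + 1 ≤ S.ncard) :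
    Good k G := by
  refine Good.step (G.deleteEdges_le _) hG (X v * X l + X w * X z)
    (Ideal.add_mem _ (edge_mem k G hvl) (edge_mem k G hwz)) ?_ hS
  intro J hJ hIJ hp
  rw [edgeIdeal_le_iff_s1] at hIJ ⊢
  have hmid : (X v * X w : MvPolynomial V k) ∈ J := by
    apply hIJ
    simp only [SimpleGraph.deleteEdges_adj, hvw, true_and, Set.mem_insert_iff,
      Set.mem_singleton_iff, Sym2.eq_iff]
    have := hvw.ne
    grind
  have h1 : (X v * X l : MvPolynomial V k) ∈ J := by
    apply hJ
    refine ⟨2, ?_⟩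
    have : (X v * X l : MvPolynomial V k) ^ 2 =
      X v * X l * (X v * X l + X w * X z) - X l * X z * (X v * X w) := by ring
    rw [this]
    exact Ideal.sub_mem _ (Ideal.mul_mem_left _ _ hp) (Ideal.mul_mem_left _ _ hmid)
  have h2 : (X w * X z : MvPolynomial V k) ∈ J := by
    have := Ideal.sub_mem _ hp h1
    simpa using this
  intro a b hab
  by_cases h : s(a, b) = s(v, l)
  · rw [Sym2.eq_iff] at h
    rcases h with ⟨rfl, rfl⟩ | ⟨rfl, rfl⟩
    · exact h1
    · rwa [mul_comm]
  by_cases h' : s(a, b) = s(w, z)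
  · rw [Sym2.eq_iff] at h'
    rcases h' with ⟨rfl, rfl⟩ | ⟨rfl, rfl⟩
    · exact h2
    · rwa [mul_comm]
  apply hIJ
  rw [SimpleGraph.deleteEdges_adj]
  refine ⟨hab, ?_⟩
  simp only [Set.mem_insert_iff, Set.mem_singleton_iff]
  tauto

lemma case_zero [Finite V] {G : SimpleGraph V} {v l : V} (hl : Leaf G l v)
    (hN : ∀ y, G.Adj v y → Leaf G y v) (S : Set V) (hS : MIS (G.deleteEdges {s(v, l)}) S) :
    ∃ T, MIS G T ∧ T.ncard + 1 ≤ S.ncard := by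
  refine swap hS (G.deleteEdges_le _) {v} (fun _ => l) ?_ ?_ v rfl ?_ ?_ ?_
  · rintro a rfl b rfl; exact G.loopless.irrefl _
  · rintro a rfl; exact hl
  · simp [SimpleGraph.deleteEdges_adj]
  · intro x y hxy hn
    have : s(x, y) = s(v, l) := by
      by_contra h
      exact hn (by simp only [SimpleGraph.deleteEdges_adj]; exact ⟨hxy, by simpa using h⟩)
    rw [Sym2.eq_iff] at this
    rcases this with ⟨rfl, rfl⟩ | ⟨rfl, rfl⟩
    · exact Or.inr ⟨x, rfl, hxy⟩
    · exact Or.inl ⟨y, rfl, hxy.symm⟩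
  · rintro y hy ⟨a, rfl, ha⟩ x hx
    exact Or.inl ((hN y ha).2 x (G.deleteEdges_le _ hx))

lemma not_del {G : SimpleGraph V} {v l w z x y : V} (hxy : G.Adj x y)
    (hn : ¬ (G.deleteEdges {s(v, l), s(w, z)}).Adj x y) :
    (x = v ∧ y = l ∨ x = l ∧ y = v) ∨ (x = w ∧ y = z ∨ x = z ∧ y = w) := by
  by_contra h
  apply hn
  rw [SimpleGraph.deleteEdges_adj]
  refine ⟨hxy, ?_⟩
  simp only [Set.mem_insert_iff, Set.mem_singleton_iff, Sym2.eq_iff]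
  exact h

lemma case_one [Finite V] {G : SimpleGraph V} {v w l t : V} (hl : Leaf G l v) (hlw : l ≠ w)
    (hvw : G.Adj v w) (hN : ∀ y, G.Adj v y → y = w ∨ Leaf G y v) (ht : Leaf G t w)
    (S : Set V) (hS : MIS (G.deleteEdges {s(v, l), s(w, t)}) S) :
    ∃ T, MIS G T ∧ T.ncard + 1 ≤ S.ncard := by
  have hle := G.deleteEdges_le {s(v, l), s(w, t)}
  by_cases hw : w ∈ S
  · have htw : t ≠ w := ht.1.ne
    have htv : t ≠ v := by
      rintro rfl
      exact hlw (ht.2 l hl.1.symm)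
    have hvS : v ∉ S := by
      intro hv
      refine hS.1 v hv w hw ?_
      by_contra h
      have := not_del hvw h
      have := hvw.ne
      grind
    have htS : t ∈ S := by
      by_contra h
      obtain ⟨y, hy, hty⟩ := hS.2 t h
      have := ht.2 y (hle hty)
      subst this
      simp [SimpleGraph.deleteEdges_adj, Sym2.eq_swap] at hty
    refine ⟨S \ {t}, ⟨?_, ?_⟩, (Set.ncard_sdiff_singleton_add_one htS (Set.toFinite S)).le⟩
    · rintro x ⟨hx, hxt⟩ y ⟨hy, hyt⟩ hxy
      have := hS.1 x hx y hy
      have := not_del hxy this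
      grind
    · intro x hx
      by_cases hxt : x = t
      · subst hxt
        exact ⟨w, ⟨hw, htw.symm⟩, ht.1⟩
      · obtain ⟨y, hy, hxy⟩ := hS.2 x (fun h => hx ⟨h, hxt⟩)
        refine ⟨y, ⟨hy, ?_⟩, hle hxy⟩
        rintro rfl
        have := ht.2 x (hle hxy).symm
        subst this
        simp [SimpleGraph.deleteEdges_adj] at hxy
  · refine swap hS hle {v} (fun _ => l) ?_ ?_ v rfl ?_ ?_ ?_
    · rintro a rfl b rfl; exact G.loopless.irrefl _
    · rintro a rfl; exact hl
    · simp [SimpleGraph.deleteEdges_adj]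
    · intro x y hxy hn
      rcases not_del hxy hn with (⟨rfl, rfl⟩ | ⟨rfl, rfl⟩) | (⟨rfl, rfl⟩ | ⟨rfl, rfl⟩)
      · exact Or.inr ⟨x, rfl, hxy⟩
      · exact Or.inl ⟨y, rfl, hxy.symm⟩
      · exact Or.inl ⟨v, rfl, hvw⟩
      · exact Or.inr ⟨v, rfl, hvw⟩
    · rintro y hy ⟨a, rfl, ha⟩ x hx
      rcases hN y ha with rfl | h
      · exact absurd hy hw
      · exact Or.inl (h.2 x (hle hx))

lemma case_two [Finite V] {G : SimpleGraph V} {v w l z : V} (hl : Leaf G l v) (hlw : l ≠ w)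
    (hvw : G.Adj v w) (hzv : z ≠ v)
    (hN : ∀ u, G.Adj w u → u = z ∨
        ((∃ m, m ≠ w ∧ Leaf G m u) ∧ ∀ y, G.Adj u y → y = w ∨ Leaf G y u))
    (S : Set V) (hS : MIS (G.deleteEdges {s(v, l), s(w, z)}) S) :
    ∃ T, MIS G T ∧ T.ncard + 1 ≤ S.ncard := by
  classical
  have hle := G.deleteEdges_le {s(v, l), s(w, z)}
  have hA1 : ∀ u, ∃ m, (G.Adj w u ∧ u ≠ z) → (m ≠ w ∧ Leaf G m u) := by
    intro u
    by_cases h : G.Adj w u ∧ u ≠ z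
    · obtain ⟨m, hm⟩ := ((hN u h.1).resolve_left h.2).1
      exact ⟨m, fun _ => hm⟩
    · exact ⟨u, fun h' => absurd h' h⟩
  choose f hf using hA1
  refine swap hS hle {u | G.Adj w u ∧ u ≠ z} (fun u => if u = v then l else f u) ?_ ?_ v
    ⟨hvw.symm, hzv.symm⟩ ?_ ?_ ?_
  · rintro a ⟨ha, haz⟩ b ⟨hb, hbz⟩ hab
    rcases ((hN a ha).resolve_left haz).2 b hab with h | h
    · exact hb.ne h.symm
    · exact ha.ne (h.2 w hb.symm)
  · rintro a ha
    by_cases h : a = v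
    · simp only [h, if_true]; exact hl
    · simp only [h, if_false]; exact (hf a ha).2
  · simp [SimpleGraph.deleteEdges_adj]
  · intro x y hxy hn
    rcases not_del hxy hn with (⟨rfl, rfl⟩ | ⟨rfl, rfl⟩) | (⟨rfl, rfl⟩ | ⟨rfl, rfl⟩)
    · exact Or.inr ⟨x, ⟨hvw.symm, hzv.symm⟩, hxy⟩
    · exact Or.inl ⟨y, ⟨hvw.symm, hzv.symm⟩, hxy.symm⟩
    · exact Or.inl ⟨v, ⟨hvw.symm, hzv.symm⟩, hvw⟩
    · exact Or.inr ⟨v, ⟨hvw.symm, hzv.symm⟩, hvw⟩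
  · rintro y hy ⟨a, ⟨ha, haz⟩, hay⟩ x hx
    rcases ((hN a ha).resolve_left haz).2 y hay with rfl | h
    · refine Or.inl ⟨hle hx, ?_⟩
      rintro rfl
      simp [SimpleGraph.deleteEdges_adj] at hx
    · rw [h.2 x (hle hx)]
      exact Or.inl ⟨ha, haz⟩

lemma good_bot (k : Type) [Field k] : Good k (⊥ : SimpleGraph V) := by
  refine ⟨Set.univ, ⟨fun _ _ _ _ h => h, fun x hx => absurd trivial hx⟩, ∅, Set.finite_empty,
    by simp, by simp, ?_⟩
  rw [edgeIdeal_le_iff_s1]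
  exact fun _ _ h => h.elim

lemma del_lt {G : SimpleGraph V} {a b : V} (hab : G.Adj a b) {E : Set (Sym2 V)}
    (hE : s(a, b) ∈ E) : G.deleteEdges E < G := by
  refine lt_of_le_of_ne (G.deleteEdges_le _) fun h => ?_
  rw [← h, SimpleGraph.deleteEdges_adj] at hab
  exact hab.2 hE

lemma good_of_HL [Finite V] (k : Type) [Field k] (G : SimpleGraph V) (hG : HL G) : Good k G := by
  induction G using WellFoundedLT.induction with
  | ind G ih =>
    by_cases hb : G = ⊥
    · rw [hb]; exact good_bot k
    rcases forest_cases hG hb with ⟨v, l, hl, hN⟩ | ⟨v, w, l, t, hl, hlw, hvw, hN, ht⟩ |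
      ⟨v, w, l, z, hl, hlw, hvw, hwz, hzv, hN⟩
    · exact Good.step_one hl.1.symm
        (ih _ (del_lt hl.1.symm (by simp)) (hG.mono (G.deleteEdges_le _)))
        (case_zero hl hN)
    · have htv : t ≠ v := by
        rintro rfl
        exact hlw (ht.2 l hl.1.symm)
      exact Good.step_two hl.1.symm ht.1.symm hvw hlw htv
        (ih _ (del_lt hl.1.symm (by simp)) (hG.mono (G.deleteEdges_le _)))
        (case_one hl hlw hvw hN ht)
    · exact Good.step_two hl.1.symm hwz hvw hlw hzv
        (ih _ (del_lt hl.1.symm (by simp)) (hG.mono (G.deleteEdges_le _)))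
        (case_two hl hlw hvw hzv hN)


/-- For a finite simple acyclic graph (a forest), the arithmetical rank of the
edge ideal equals its big height. -/
theorem stmt1 {V : Type} [Fintype V] (k : Type) [Field k] (G : SimpleGraph V)
    (hacyclic : ∀ (u : V) (c : G.Walk u u), ¬ c.IsCycle) :
    ara k G = bight G := by
  classical
  obtain ⟨S, hS, Q, hQf, hQc, hQI, hIQ⟩ := good_of_HL k G (acyclic_HL hacyclic)
  have hbdd : BddAbove {n : ℕ | ∃ C : Set V, IsMinVC G C ∧ C.ncard = n} := by
    refine ⟨Nat.card V, ?_⟩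
    rintro _ ⟨C, -, rfl⟩
    exact Set.ncard_le_card C
  have hrad : (Ideal.span Q).radical = edgeIdeal k G := by
    apply le_antisymm _ hIQ
    rw [(edgeIdeal_radical k G).radical_le_iff, Ideal.span_le]
    exact hQI
  have hmem : Q.ncard ∈ {r : ℕ | ∃ q : Fin r → MvPolynomial V k,
      (Ideal.span (Set.range q)).radical = edgeIdeal k G} := by
    have : Finite Q := hQf
    let e : Q ≃ Fin Q.ncard := Finite.equivFinOfCardEq rfl
    refine ⟨fun i => (e.symm i : MvPolynomial V k), ?_⟩
    have : Set.range (fun i => (e.symm i : MvPolynomial V k)) = Q := by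
      ext p
      constructor
      · rintro ⟨i, rfl⟩
        exact (e.symm i).2
      · intro hp
        exact ⟨e ⟨p, hp⟩, by simp⟩
    rw [this, hrad]
  unfold ara bight
  apply le_antisymm
  · exact (Nat.sInf_le hmem).trans (hQc.trans (le_csSup hbdd ⟨_, hS.isMinVC, rfl⟩))
  · refine csSup_le ⟨_, _, hS.isMinVC, rfl⟩ ?_
    rintro _ ⟨C, hC, rfl⟩
    obtain ⟨q, hq⟩ := Nat.sInf_mem (Set.nonempty_of_mem hmem)
    exact lower_bound k G hC hq
end

section
/- Let G be a finite simple graph and let x_1 and x_2 be two leaves of G belonging to vertex-disjoint edges (so their unique neighbours y_1 and y_2 are distinct and the edges x_1y_1 and x_2y_2 share no vertex). Let Ġ be the graph obtained from G by identifying x_1 and x_2 into a single vertex. Then bight I(Ġ) ≥ bight I(G) − 1, i.e., the maximum cardinality of a minimal vertex cover of Ġ is at least the maximum cardinality of a minimal vertex cover of G minus one. -/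
open SimpleGraph

variable {V : Type}

theorem aux_min {V : Type} (H : SimpleGraph V) (C : Set V) (hC : IsVC H C)
    (hp : ∀ v ∈ C, ∃ w, H.Adj v w ∧ w ∉ C) : IsMinVC H C := by
  refine ⟨hC, fun D hD hV => ?_⟩
  obtain ⟨v, hv, hvD⟩ := Set.exists_of_ssubset hD
  obtain ⟨w, hw, hwC⟩ := hp v hv
  rcases hV hw with h | h
  · exact hvD h
  · exact hwC (hD.1 h)

theorem aux_priv {V : Type} (H : SimpleGraph V) (C : Set V) (hC : IsMinVC H C) :
    ∀ v ∈ C, ∃ w, H.Adj v w ∧ w ∉ C := by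
  intro v hv
  by_contra hcon
  push Not at hcon
  refine hC.2 (C \ {v}) (Set.diff_singleton_ssubset.2 hv) ?_
  intro a b hab
  have hne := hab.ne
  have h1 := hC.1 hab
  have h2 := hcon a
  have h3 := hcon b
  have h4 := hab.symm
  simp only [Set.mem_diff, Set.mem_singleton_iff]
  grind

theorem aux_le {V : Type} [Fintype V] (H : SimpleGraph V) (C : Set V) (hC : IsMinVC H C) :
    C.ncard ≤ bight H := by
  refine le_csSup ⟨Fintype.card V, ?_⟩ ⟨C, hC, rfl⟩
  rintro n ⟨D, -, rfl⟩
  rw [← Nat.card_eq_fintype_card]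
  exact Set.ncard_le_card D

theorem aux_drop {V : Type} [Fintype V] (H : SimpleGraph V) (C : Set V) (p : V) (hC : IsVC H C)
    (hp : ∀ v ∈ C, v ≠ p → ∃ w, H.Adj v w ∧ w ∉ C) : C.ncard - 1 ≤ bight H := by
  by_cases h : ∃ w, H.Adj p w ∧ w ∉ C
  · have := aux_le H C (aux_min H C hC (fun v hv => by
      by_cases e : v = p
      · exact e ▸ h
      · exact hp v hv e))
    omega
  · push Not at h
    refine (Set.pred_ncard_le_ncard_diff_singleton C p).trans (aux_le H (C \ {p}) (aux_min _ _ ?_ ?_))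
    · intro a b hab
      have hne := hab.ne
      have h1 := hC hab
      have h2 := h a
      have h3 := h b
      have h4 := hab.symm
      simp only [Set.mem_diff, Set.mem_singleton_iff]
      grind
    · rintro v ⟨hv, hvp⟩
      obtain ⟨w, hw, hwC⟩ := hp v hv hvp
      exact ⟨w, hw, fun h => hwC h.1⟩

/-- Identifying two leaves `x₁, x₂` of `G` lying on vertex-disjoint edges
(`Gdot` is `G` with the edge `x₂y₂` replaced by `x₁y₂`, the identified vertex
being `x₁`, and `x₂` becoming isolated) decreases the big height by at most
one. -/
theorem stmt2 {V : Type} [Fintype V] (G Gdot : SimpleGraph V) (x₁ x₂ y₁ y₂ : V)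
    (hleaf₁ : G.neighborSet x₁ = {y₁}) (hleaf₂ : G.neighborSet x₂ = {y₂})
    (hx : x₁ ≠ x₂) (hy : y₁ ≠ y₂) (hxy₁ : x₁ ≠ y₂) (hxy₂ : x₂ ≠ y₁)
    (hdot : ∀ u v : V, Gdot.Adj u v ↔
      ((G.Adj u v ∧ s(u, v) ≠ s(x₂, y₂)) ∨ s(u, v) = s(x₁, y₂))) :
    bight G - 1 ≤ bight Gdot := by
  have l1 : ∀ v, G.Adj x₁ v ↔ v = y₁ := fun v => by
    rw [← mem_neighborSet, hleaf₁, Set.mem_singleton_iff]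
  have l2 : ∀ v, G.Adj x₂ v ↔ v = y₂ := fun v => by
    rw [← mem_neighborSet, hleaf₂, Set.mem_singleton_iff]
  have hsymm : ∀ u v, G.Adj u v → G.Adj v u := fun u v h => h.symm
  have hirr : ∀ u, ¬ G.Adj u u := fun u => G.irrefl
  simp only [ne_eq, Sym2.eq_iff] at hdot
  rcases Set.eq_empty_or_nonempty {n : ℕ | ∃ C : Set V, IsMinVC G C ∧ C.ncard = n} with he | hne
  · have : bight G = 0 := by unfold bight; rw [he]; simp
    omega
  have hbd : BddAbove {n : ℕ | ∃ C : Set V, IsMinVC G C ∧ C.ncard = n} := by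
    refine ⟨Fintype.card V, ?_⟩
    rintro n ⟨D, -, rfl⟩
    rw [← Nat.card_eq_fintype_card]
    exact Set.ncard_le_card D
  obtain ⟨C, hC, hcard⟩ := Nat.sSup_mem hne hbd
  change C.ncard = bight G at hcard
  rw [← hcard]
  have hpr := aux_priv G C hC
  have hvc : ∀ u v, G.Adj u v → u ∈ C ∨ v ∈ C := fun u v h => hC.1 h
  clear hbd hne hcard hC hleaf₁ hleaf₂
  have e1 := hvc x₁ y₁ ((l1 _).2 rfl)
  have e2 := hvc x₂ y₂ ((l2 _).2 rfl)
  have f1 : x₁ ∈ C → y₁ ∉ C := fun h => by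
    obtain ⟨w, hw, hwC⟩ := hpr _ h
    rwa [(l1 w).1 hw] at hwC
  have f2 : x₂ ∈ C → y₂ ∉ C := fun h => by
    obtain ⟨w, hw, hwC⟩ := hpr _ h
    rwa [(l2 w).1 hw] at hwC
  by_cases h1 : x₁ ∈ C
  · by_cases h2 : x₂ ∈ C
    · refine (Set.pred_ncard_le_ncard_diff_singleton C x₂).trans
        (aux_le _ (C \ {x₂}) (aux_min _ _ ?_ ?_))
      · intro a b hab
        simp only [Set.mem_diff, Set.mem_singleton_iff]
        grind
      · rintro v ⟨hv, hv2⟩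
        obtain ⟨w, hw, hwC⟩ := hpr v hv
        refine ⟨w, ?_, fun h => hwC h.1⟩
        simp only [Set.mem_singleton_iff] at hv2
        grind
    · refine aux_drop _ C y₂ ?_ ?_
      · intro a b hab
        grind
      · intro v hv hv2
        obtain ⟨w, hw, hwC⟩ := hpr v hv
        refine ⟨w, ?_, hwC⟩
        grind
  · by_cases h2 : x₂ ∈ C
    · have hc : (insert x₁ (C \ {x₂})).ncard = C.ncard := by
        rw [Set.ncard_insert_of_notMem (fun h => h1 h.1)]
        exact Set.ncard_diff_singleton_add_one h2
      rw [← hc]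
      refine aux_drop _ _ y₁ ?_ ?_
      · intro a b hab
        simp only [Set.mem_insert_iff, Set.mem_diff, Set.mem_singleton_iff]
        grind
      · intro v hv hv2
        simp only [Set.mem_insert_iff, Set.mem_diff, Set.mem_singleton_iff] at hv ⊢
        by_cases e : v = x₁
        · refine ⟨y₂, ?_, ?_⟩ <;> grind
        · obtain ⟨w, hw, hwC⟩ := hpr v (by grind)
          refine ⟨w, ?_, ?_⟩ <;> grind
    · refine (Nat.sub_le _ _).trans (aux_le _ C (aux_min _ _ ?_ ?_))
      · intro a b hab
        grind
      · intro v hv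
        by_cases e : v = y₂
        · refine ⟨x₁, ?_, h1⟩
          grind
        · obtain ⟨w, hw, hwC⟩ := hpr v hv
          refine ⟨w, ?_, hwC⟩
          grind
end

section
/- Let H be a subgraph of a finite simple graph G and let x be a vertex of G such that the vertex sets of H and of G∖H (the graph whose edge set is E(G)∖E(H)) intersect exactly in {x}. Let C be a minimal vertex cover of G and let D = C ∩ V(H) be the vertex cover induced by C on H. If x ∉ C, then D is a minimal vertex cover of H. -/
open SimpleGraph

variable {V : Type}

/-- If `H` is a subgraph of `G` whose vertex set meets the vertex set of
`G ∖ H` exactly in `{x}`, and `C` is a minimal vertex cover of `G` with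
`x ∉ C`, then the vertex cover `C ∩ V(H)` induced by `C` on `H` is a minimal
vertex cover of `H`. -/
theorem stmt6 {V : Type} [Fintype V] (G H : SimpleGraph V) (hHG : H ≤ G)
    (x : V) (hx : H.support ∩ (G \ H).support = {x})
    (C : Set V) (hC : IsMinVC G C) (hxC : x ∉ C) :
    IsMinVC H (C ∩ H.support) := by
  obtain ⟨hcov, hmin⟩ := hC
  have key : ∀ {u v : V}, G.Adj u v → ¬ H.Adj u v → u ∈ C → u ∉ H.support := by
    intro u v hG hH huC huS
    have h1 : u ∈ H.support ∩ (G \ H).support :=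
      ⟨huS, (SimpleGraph.mem_support _).2 ⟨v, (SimpleGraph.sdiff_adj _ _ _ _).2 ⟨hG, hH⟩⟩⟩
    rw [hx] at h1
    have h2 : u = x := h1
    exact hxC (h2 ▸ huC)
  refine ⟨?_, ?_⟩
  · intro u v h
    rcases hcov (hHG h) with hu | hv
    · exact Or.inl ⟨hu, (SimpleGraph.mem_support _).2 ⟨v, h⟩⟩
    · exact Or.inr ⟨hv, (SimpleGraph.mem_support _).2 ⟨u, h.symm⟩⟩
  · intro D hD hDcov
    obtain ⟨hsub, hnot⟩ := hD
    refine hmin (D ∪ (C \ H.support)) ⟨?_, ?_⟩ ?_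
    · rintro a (ha | ha)
      · exact (hsub ha).1
      · exact ha.1
    · intro hle
      apply hnot
      intro a ha
      rcases hle ha.1 with h | h
      · exact h
      · exact absurd ha.2 h.2
    · intro u v h
      by_cases hH : H.Adj u v
      · rcases hDcov hH with h | h
        · exact Or.inl (Or.inl h)
        · exact Or.inr (Or.inl h)
      · rcases hcov h with hu | hv
        · exact Or.inl (Or.inr ⟨hu, key h hH hu⟩)
        · exact Or.inr (Or.inr ⟨hv, key h.symm (fun h' => hH h'.symm) hv⟩)
end

section
/- Let H be a subgraph of a finite simple graph G and let x be a vertex of G such that the vertex sets of H and of G∖H (the graph whose edge set is E(G)∖E(H)) intersect exactly in {x}. Let C be a minimal vertex cover of G and let D = C ∩ V(H) be the vertex cover induced by C on H. If x ∈ C, then D or D∖{x} is a minimal vertex cover of H. -/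
open SimpleGraph

variable {V : Type}

theorem IsMinVC.exists_outside_nbr {V : Type} {G : SimpleGraph V} {C : Set V} (hC : IsMinVC G C)
    {v : V} (hv : v ∈ C) : ∃ w, G.Adj v w ∧ w ∉ C := by
  by_contra hcon
  push Not at hcon
  refine hC.2 (C \ {v}) ⟨Set.sdiff_subset, fun h => (h hv).2 rfl⟩ ?_
  intro a b hab
  by_cases ha : a = v
  · subst ha
    exact Or.inr ⟨hcon b hab, fun h => hab.ne h.symm⟩
  · by_cases hb : b = v
    · subst hb
      exact Or.inl ⟨hcon a hab.symm, ha⟩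
    · rcases hC.1 hab with h | h
      · exact Or.inl ⟨h, ha⟩
      · exact Or.inr ⟨h, hb⟩

theorem isMinVC_of_outside_nbr {V : Type} {G : SimpleGraph V} {C : Set V} (hC : IsVC G C)
    (hp : ∀ v ∈ C, ∃ w, G.Adj v w ∧ w ∉ C) : IsMinVC G C := by
  refine ⟨hC, fun D hD hcov => ?_⟩
  obtain ⟨v, hvC, hvD⟩ := Set.exists_of_ssubset hD
  obtain ⟨w, hw, hwC⟩ := hp v hvC
  rcases hcov hw with h | h
  · exact hvD h
  · exact hwC (hD.1 h)

/-- If `H` is a subgraph of `G` whose vertex set meets the vertex set of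
`G ∖ H` exactly in `{x}`, and `C` is a minimal vertex cover of `G` with
`x ∈ C`, then, for the vertex cover `D = C ∩ V(H)` induced by `C` on `H`,
either `D` or `D ∖ {x}` is a minimal vertex cover of `H`. -/
theorem stmt7 {V : Type} [Fintype V] (G H : SimpleGraph V) (hHG : H ≤ G)
    (x : V) (hx : H.support ∩ (G \ H).support = {x})
    (C : Set V) (hC : IsMinVC G C) (hxC : x ∈ C) :
    IsMinVC H (C ∩ H.support) ∨ IsMinVC H ((C ∩ H.support) \ {x}) := by
  have hcov : IsVC H (C ∩ H.support) := by
    intro a b hab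
    rcases hC.1 (hHG hab) with h | h
    · exact Or.inl ⟨h, b, hab⟩
    · exact Or.inr ⟨h, a, hab.symm⟩
  have hpriv : ∀ v ∈ C ∩ H.support, v ≠ x → ∃ w, H.Adj v w ∧ w ∉ C := by
    intro v hv hvx
    obtain ⟨w, hw, hwC⟩ := hC.exists_outside_nbr hv.1
    refine ⟨w, ?_, hwC⟩
    by_contra hn
    have hm : v ∈ H.support ∩ (G \ H).support := ⟨hv.2, w, hw, hn⟩
    rw [hx] at hm
    exact hvx hm
  by_cases hxp : ∃ w, H.Adj x w ∧ w ∉ C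
  · left
    refine isMinVC_of_outside_nbr hcov fun v hv => ?_
    by_cases hvx : v = x
    · obtain ⟨w, hw, hwC⟩ := hxp
      exact ⟨w, hvx ▸ hw, fun h => hwC h.1⟩
    · obtain ⟨w, hw, hwC⟩ := hpriv v hv hvx
      exact ⟨w, hw, fun h => hwC h.1⟩
  · right
    push Not at hxp
    refine isMinVC_of_outside_nbr ?_ fun v hv => ?_
    · intro a b hab
      by_cases ha : a = x
      · subst ha
        exact Or.inr ⟨⟨hxp b hab, a, hab.symm⟩, fun h => hab.ne h.symm⟩
      · by_cases hb : b = x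
        · subst hb
          exact Or.inl ⟨⟨hxp a hab.symm, b, hab⟩, ha⟩
        · rcases hcov hab with h | h
          · exact Or.inl ⟨h, ha⟩
          · exact Or.inr ⟨h, hb⟩
    · obtain ⟨w, hw, hwC⟩ := hpriv v hv.1 hv.2
      exact ⟨w, hw, fun h => hwC h.1.1⟩
end
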